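/- The map a ↦ (P_HMᴼ(a), Q_HMᴼ(a)) is a bijection from the set of primed words all of whose letters are positive to the set of pairs (P, Q) of shifted tableaux of the same shape in which P is semistandard, Q is standard, and Q has no primed entries on the main diagonal. Likewise, the map a ↦ (P_HM^Sp(a), Q_HM^Sp(a)) is a bijection from the same set of primed words to the set of pairs (P, Q) of shifted tableaux of the same shape in which P is semistandard, Q is standard, and P has no primed entries on the main diagonal. -/

import Mathlib

/-! ## Primed letters: the alphabet `ℤ ⊔ ℤ'`, with `i' = i - 1/2`.
A letter is encoded by its "ceiling" together with a flag recording whether it is primed. -/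

structure Letter where
  ceil : ℤ
  primed : Bool
deriving DecidableEq, Repr

instance : Inhabited Letter := ⟨⟨0, false⟩⟩

/-- The order `⋯ < 1' < 1 < 2' < 2 < ⋯`. -/
instance : LinearOrder Letter :=
  LinearOrder.lift' (fun x : Letter => toLex (x.ceil, !x.primed))
    (fun a b h => by
      have h' : (a.ceil, !a.primed) = (b.ceil, !b.primed) := toLex.injective h
      obtain ⟨ac, ap⟩ := a
      obtain ⟨bc, bp⟩ := b
      simp only [Prod.mk.injEq] at h'
      obtain ⟨h1, h2⟩ := h'
      cases ap <;> cases bp <;> simp_all)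

/-- A primed word. -/
abbrev PWord := List Letter

def Letter.unprime (x : Letter) : Letter := ⟨x.ceil, false⟩

def Letter.succL (x : Letter) : Letter := ⟨x.ceil + 1, x.primed⟩

/-- `unprime` of a primed word: replace each letter `x` by `⌈x⌉`. -/
def unprimeWord (a : PWord) : List ℤ := a.map Letter.ceil

/-- `unprime` of a primed word, as a primed word with no primes. -/
def unprimeP (a : PWord) : PWord := a.map Letter.unprime

/-! ## Involution words -/

/-- The simple transposition `s_i = (i, i+1)` of `ℤ`. -/
def sPerm (i : ℤ) : Equiv.Perm ℤ := Equiv.swap i (i + 1)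

/-- The Demazure product `s_{w_1} ∘ s_{w_2} ∘ ⋯ ∘ s_{w_k}` of a word, computed by the
defining recursion `σ ∘ s_i = σ·s_i` if `σ(i) < σ(i+1)` and `σ ∘ s_i = σ` otherwise. -/
def heckeProd (w : List ℤ) : Equiv.Perm ℤ :=
  w.foldl (fun σ i => if σ i < σ (i + 1) then σ * sPerm i else σ) 1

/-- `s_{a_n} ∘ ⋯ ∘ s_{a_2} ∘ s_{a_1} ∘ s_{a_2} ∘ ⋯ ∘ s_{a_n}` for `a = a_1 a_2 ⋯ a_n`. -/
def invHecke (a : List ℤ) : Equiv.Perm ℤ := heckeProd (a.reverse ++ a.tail)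

/-- Membership in `I_ℤ`: a finitely supported involution of `ℤ`. -/
def IZ (z : Equiv.Perm ℤ) : Prop := {x : ℤ | z x ≠ x}.Finite ∧ z * z = 1

/-- The set of involution words of `z`. -/
def Rinv (z : Equiv.Perm ℤ) : Set (List ℤ) :=
  {a | invHecke a = z ∧ ∀ b : List ℤ, invHecke b = z → a.length ≤ b.length}

/-- 0-based index `k` is a commutation in the word `a` (this corresponds to the 1-based
index `k+1`): `a_{k+1}` and `a_{k+1} + 1` are both fixed points of
`s_{a_k} ∘ ⋯ ∘ s_{a_1} ∘ ⋯ ∘ s_{a_k}`. -/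
def IsCommutation (a : List ℤ) (k : ℕ) : Prop :=
  ∃ x, a[k]? = some x ∧ invHecke (a.take k) x = x ∧ invHecke (a.take k) (x + 1) = x + 1

/-- The set of primed involution words of `z`. -/
def RinvPlus (z : Equiv.Perm ℤ) : Set PWord :=
  {a | unprimeWord a ∈ Rinv z ∧
     ∀ (k : ℕ) (x : Letter), a[k]? = some x → x.primed = true →
       IsCommutation (unprimeWord a) k}

/-! ## Shifted tableaux.
A shifted tableau is recorded as its list of rows, from the first (bottom) row upward;
the entry at 0-based index `k` of 0-based row `r` occupies the box in row `r+1` and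
column `r+1+k` of the shifted diagram. -/

abbrev STab := List (List Letter)

/-- A strict partition, recorded as its (strictly decreasing) list of positive parts. -/
def IsStrictPartition (sh : List ℕ) : Prop :=
  List.Chain' (fun a b => b < a) sh ∧ ∀ m ∈ sh, 0 < m

def shapeOf {α : Type*} (T : List (List α)) : List ℕ := T.map List.length

/-- The rows form the shifted diagram of a strict partition. -/
def IsShifted {α : Type*} (T : List (List α)) : Prop := IsStrictPartition (shapeOf T)

/-- The entry of `T` in (0-based) row `r` and column `c` of the shifted diagram. -/
def entryG? {α : Type*} (T : List (List α)) (r c : ℕ) : Option α :=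
  if r ≤ c then (T[r]?).bind (fun row => row[c - r]?) else none

def entry? (T : STab) (r c : ℕ) : Option Letter := entryG? T r c

def setRowG {α : Type*} (T : List (List α)) (r : ℕ) (row : List α) : List (List α) :=
  if r < T.length then T.set r row else T ++ [row]

def setEntryG {α : Type*} (T : List (List α)) (r c : ℕ) (x : α) : List (List α) :=
  T.set r ((T.getD r []).set (c - r) x)

def numCols {α : Type*} (T : List (List α)) : ℕ := (T.getD 0 []).length

/-- Row reading word: rows left to right, starting with the last (top) row. -/
def rowWord (T : STab) : PWord := T.reverse.flatten

/-- Column reading word: columns top to bottom, starting with the first column. -/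
def colWord (T : STab) : PWord :=
  (List.range (numCols T)).flatMap (fun c =>
    ((List.range (c + 1)).reverse).filterMap (fun r => entry? T r c))

def unprimeT (T : STab) : STab := T.map (List.map Letter.unprime)

/-- Remove the primes from all main-diagonal entries. -/
def unprimeDiagT (T : STab) : STab :=
  T.map (fun row =>
    match row with
    | [] => []
    | x :: rest => Letter.unprime x :: rest)

/-- Rows and columns are strictly increasing. -/
def IsIncreasing (T : STab) : Prop :=
  (∀ r c x y, entry? T r c = some x → entry? T r (c + 1) = some y → x < y) ∧
  (∀ r c x y, entry? T r c = some x → entry? T (r + 1) c = some y → x < y)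

/-- No primed entries on the main diagonal. -/
def NoDiagPrimes (T : STab) : Prop :=
  ∀ r x, entry? T r r = some x → x.primed = false

/-- Entries positive, rows and columns weakly increasing, no primed entry repeated
in a row and no unprimed entry repeated in a column. -/
def IsSemistandard (T : STab) : Prop :=
  (∀ x ∈ T.flatten, 0 < x.ceil) ∧
  (∀ r c x y, entry? T r c = some x → entry? T r (c + 1) = some y → x ≤ y) ∧
  (∀ r c x y, entry? T r c = some x → entry? T (r + 1) c = some y → x ≤ y) ∧
  (∀ r c c' x, c < c' → entry? T r c = some x → entry? T r c' = some x →
    x.primed = false) ∧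
  (∀ r r' c x, r < r' → entry? T r c = some x → entry? T r' c = some x →
    x.primed = true)

/-- Increasing, with exactly one of `i` or `i'` as an entry for each `i = 1, …, n`,
where `n` is the number of boxes. -/
def IsStandard (T : STab) : Prop :=
  IsIncreasing T ∧
  ∀ i : ℤ, 1 ≤ i → i ≤ (T.flatten.length : ℤ) →
    T.flatten.countP (fun x => decide (x.ceil = i)) = 1
/-! ## Orthogonal Edelman–Greene insertion -/

/-- "Switching the primes" of a pair: reverse the primes on both letters if exactly one
of them is unprimed, and leave them unchanged otherwise. -/
def switchPrimes (x y : Letter) : Letter × Letter :=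
  if x.primed = y.primed then (x, y)
  else (⟨x.ceil, !x.primed⟩, ⟨y.ceil, !y.primed⟩)

/-- Column-insertion stage of orthogonal Edelman–Greene insertion:
insert letter `w` into column `c` of `T` (then continue into later columns). -/
def egCol : ℕ → STab → ℕ → Letter → STab × Bool
  | 0, T, _, _ => (T, true)
  | fuel + 1, T, c, w =>
    let occ := (List.range (c + 1)).filterMap (fun r => (entry? T r c).map (fun x => (r, x)))
    match occ.findIdx? (fun p => decide (w.ceil < p.2.ceil)) with
    | none =>
        -- place `w` in the first empty box of the column
        let r := occ.length
        let w' := if r = c ∧ w.primed then Letter.unprime w else w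
        (setRowG T r ((T.getD r []) ++ [w']), if r = c then w.primed else true)
    | some kM =>
        let km := (occ.findIdx? (fun p => decide (w.ceil ≤ p.2.ceil))).getD kM
        let im := (occ.getD km (0, default)).1
        let m := (occ.getD km (0, default)).2
        if km = kM then
          if im = c then
            -- m = M on the main diagonal
            egCol fuel (setEntryG T im c (Letter.unprime w)) (c + 1) ⟨m.ceil, w.primed⟩
          else
            -- m = M off the main diagonal
            egCol fuel (setEntryG T im c w) (c + 1) m
        else
          -- m < M : switch the primes on m and M, insert w+1 into the next column
          let iM := (occ.getD kM (0, default)).1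
          let M := (occ.getD kM (0, default)).2
          let p := switchPrimes m M
          egCol fuel (setEntryG (setEntryG T im c p.1) iM c p.2) (c + 1) (Letter.succL w)

/-- Row-insertion stage of orthogonal Edelman–Greene insertion:
insert letter `w` into row `r` of `T`. -/
def egRow : ℕ → STab → ℕ → Letter → STab × Bool
  | 0, T, _, _ => (T, true)
  | fuel + 1, T, r, w =>
    let row := T.getD r []
    match row.findIdx? (fun x => decide (w.ceil < x.ceil)) with
    | none =>
        if row.isEmpty ∧ w.primed then (setRowG T r [Letter.unprime w], true)
        else (setRowG T r (row ++ [w]), false)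
    | some kM =>
        let km := (row.findIdx? (fun x => decide (w.ceil ≤ x.ceil))).getD kM
        let m := row.getD km default
        if km = kM then
          if km = 0 then
            -- m = M on the main diagonal
            egCol fuel (setRowG T r (row.set 0 (Letter.unprime w))) (r + 1)
              ⟨m.ceil, w.primed⟩
          else
            -- m = M off the main diagonal
            egRow fuel (setRowG T r (row.set km w)) (r + 1) m
        else
          -- m < M : switch primes; insert w+1 into the next column (if m is on the
          -- main diagonal) or the next row (otherwise)
          let M := row.getD kM default
          let p := switchPrimes m M
          let row' := (row.set km p.1).set kM p.2
          if km = 0 then egCol fuel (setRowG T r row') (r + 1) (Letter.succL w)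
          else egRow fuel (setRowG T r row') (r + 1) (Letter.succL w)

/-- `T ←ᴼ u` together with the flag recording whether the insertion ended in
column insertion. -/
def egInsert (T : STab) (u : Letter) : STab × Bool :=
  egRow (T.flatten.length + T.length + 2) T 0 u

/-- The orthogonal Edelman–Greene insertion tableau `P_EGᴼ(a)`. -/
def PEG (a : PWord) : STab := a.foldl (fun T u => (egInsert T u).1) []

/-- Add the recording letter `x` to `Q` in the unique box of `Pnew` not in `Pold`. -/
def addBox (Q Pold Pnew : STab) (x : Letter) : STab :=
  match (List.range Pnew.length).find?
      (fun r => decide ((Pold.getD r []).length ≠ (Pnew.getD r []).length)) with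
  | some r => setRowG Q r ((Q.getD r []) ++ [x])
  | none => Q

def QEGaux : STab → STab → ℕ → PWord → STab
  | _, Q, _, [] => Q
  | P, Q, n, u :: rest =>
      let res := egInsert P u
      QEGaux res.1 (addBox Q P res.1 ⟨(n : ℤ), res.2⟩) (n + 1) rest

/-- The orthogonal Edelman–Greene recording tableau `Q_EGᴼ(a)`. -/
def QEG (a : PWord) : STab := QEGaux [] [] 1 a

/-! ## Orthogonal Coxeter–Knuth operators -/

def ock1 (x : Letter) : Letter := ⟨x.ceil, !x.primed⟩

def ock2 (x y : Letter) : Letter × Letter := (⟨y.ceil, x.primed⟩, ⟨x.ceil, y.primed⟩)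

def ock3 (x y z : Letter) : Letter × Letter × Letter :=
  if x.ceil = z.ceil ∧ (x.ceil - y.ceil = 1 ∨ y.ceil - x.ceil = 1) then
    if x.primed = false ∧ y.primed = false ∧ z.primed = false then
      -- XYX ↔ YXY
      (⟨y.ceil, false⟩, ⟨x.ceil, false⟩, ⟨y.ceil, false⟩)
    else if x.primed = true ∧ y.primed = false ∧ z.primed = false then
      -- X'YX ↦ YXY'
      (⟨y.ceil, false⟩, ⟨x.ceil, false⟩, ⟨y.ceil, true⟩)
    else if x.primed = false ∧ y.primed = false ∧ z.primed = true then
      -- YXY' ↦ X'YX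
      (⟨y.ceil, true⟩, ⟨x.ceil, false⟩, ⟨y.ceil, false⟩)
    else (x, y, z)
  else if (x.ceil < z.ceil ∧ z.ceil < y.ceil) ∨ (y.ceil < z.ceil ∧ z.ceil < x.ceil) then
    -- ACB ↔ CAB
    (y, x, z)
  else if (y.ceil < x.ceil ∧ x.ceil < z.ceil) ∨ (z.ceil < x.ceil ∧ x.ceil < y.ceil) then
    -- BCA ↔ BAC
    (x, z, y)
  else (x, y, z)

/-- The operator `ock_i` for `i ∈ ℤ`. -/
def ockW (i : ℤ) (a : PWord) : PWord :=
  if i = -1 then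
    match a with
    | [] => []
    | x :: rest => ock1 x :: rest
  else if i = 0 then
    match a with
    | x :: y :: rest => (ock2 x y).1 :: (ock2 x y).2 :: rest
    | _ => a
  else if 1 ≤ i ∧ i + 2 ≤ (a.length : ℤ) then
    let k := (i - 1).toNat
    match a[k]?, a[k + 1]?, a[k + 2]? with
    | some x, some y, some z =>
        a.take k ++ [(ock3 x y z).1, (ock3 x y z).2.1, (ock3 x y z).2.2] ++ a.drop (k + 3)
    | _, _, _ => a
  else a

/-- Orthogonal Coxeter–Knuth equivalence: generated by `a ∼ ock_i(a)` for all `i ∈ ℤ`. -/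
def OckEquiv : PWord → PWord → Prop :=
  Relation.EqvGen (fun a b => ∃ i : ℤ, b = ockW i a)
/-! ## Descents -/

/-- Descent set of a primed word (as a set of 1-based positions). -/
def DesWord (a : PWord) : Set ℤ :=
  {i | ∃ k : ℕ, i = (k : ℤ) + 1 ∧ ∃ x y, a[k]? = some x ∧ a[k + 1]? = some y ∧ y < x}

/-- Descent set of a standard shifted tableau. -/
def DesT (T : STab) : Set ℤ :=
  {i | 0 < i ∧ (
    (∃ r c r' c', entry? T r c = some ⟨i, false⟩ ∧
        entry? T r' c' = some ⟨i + 1, false⟩ ∧ r < r') ∨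
    (∃ r c r' c', entry? T r c = some ⟨i, true⟩ ∧
        entry? T r' c' = some ⟨i + 1, true⟩ ∧ c < c') ∨
    (∃ r c r' c', entry? T r c = some ⟨i, false⟩ ∧
        entry? T r' c' = some ⟨i + 1, true⟩))}

/-! ## Dual equivalence operators on standard shifted tableaux -/

def numPrimes (T : STab) : ℕ := T.flatten.countP (fun x => x.primed)

/-- The entries of column `c`, read from bottom to top (increasing). -/
def colLetters (T : STab) (c : ℕ) : PWord :=
  (List.range (c + 1)).filterMap (fun r => entry? T r c)

/-- The shifted reading word `unprime(C_q R_q ⋯ C_1 R_1)`. -/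
def shword (T : STab) : List ℤ :=
  (((List.range (numCols T)).reverse).flatMap (fun idx =>
    (colLetters T idx).filter (fun x => x.primed) ++
      ((T.getD idx []).filter (fun x => !x.primed)))).map Letter.ceil

def idxOfZ (v : ℤ) : List ℤ → ℕ
  | [] => 0
  | x :: r => if x = v then 0 else idxOfZ v r + 1

def positionsOf (T : STab) : List (ℕ × ℕ) :=
  (List.range T.length).flatMap (fun r =>
    (List.range (T.getD r []).length).map (fun k => (r, r + k)))

/-- The box `□_v` of `T` containing `v` or `v'`. -/
def boxOf (T : STab) (v : ℤ) : Option (ℕ × ℕ) :=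
  (positionsOf T).find? (fun p =>
    match entry? T p.1 p.2 with
    | some x => decide (x.ceil = v)
    | none => false)

/-- Reverse the prime of the entry in position `(r, c)`. -/
def togglePos (T : STab) (r c : ℕ) : STab :=
  match entry? T r c with
  | some x => setEntryG T r c ⟨x.ceil, !x.primed⟩
  | none => T

/-- Switch the primes of the entries in the two given positions. -/
def switchAt (T : STab) (p q : ℕ × ℕ) : STab :=
  match entry? T p.1 p.2, entry? T q.1 q.2 with
  | some x, some y =>
      if x.primed = y.primed then T else togglePos (togglePos T p.1 p.2) q.1 q.2
  | _, _ => T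

/-- The row index of `□_v` if it is a main-diagonal box. -/
def diagBox? (T : STab) (v : ℤ) : Option ℕ :=
  (boxOf T v).bind (fun p => if p.1 = p.2 then some p.1 else none)

def switchDiag (T T' : STab) (u v : ℤ) : STab :=
  match diagBox? T u, diagBox? T v with
  | some r, some s => switchAt T' (r, r) (s, s)
  | _, _ => T'

/-- The operator `𝔰_i`. -/
def sOp (i : ℤ) (T : STab) : STab :=
  match boxOf T i, boxOf T (i + 1) with
  | some (r1, c1), some (r2, c2) =>
      if r1 ≠ r2 ∧ c1 ≠ c2 then
        -- swap i ↔ i+1 and i' ↔ (i+1)'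
        setEntryG (setEntryG T r1 c1 ⟨i + 1, ((entry? T r1 c1).getD default).primed⟩)
          r2 c2 ⟨i, ((entry? T r2 c2).getD default).primed⟩
      else if r1 ≠ c1 ∧ r2 ≠ c2 then
        -- same row or column, neither box diagonal: reverse both primes
        togglePos (togglePos T r1 c1) r2 c2
      else
        -- same row or column, one box diagonal
        let T1 := if r1 = c1 then togglePos T r2 c2 else togglePos T r1 c1
        let T2 :=
          if 1 ≤ i - 1 ∧ (diagBox? T (i - 1)).isSome ∧ (diagBox? T (i + 1)).isSome then
            switchDiag T T1 (i - 1) (i + 1)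
          else T1
        if i + 2 ≤ (T.flatten.length : ℤ) ∧ (diagBox? T i).isSome ∧
            (diagBox? T (i + 2)).isSome then
          switchDiag T T2 i (i + 2)
        else T2
  | _, _ => T

def btwn (a m b : ℕ) : Prop := (a < m ∧ m < b) ∨ (b < m ∧ m < a)

instance (a m b : ℕ) : Decidable (btwn a m b) := by unfold btwn; infer_instance

/-- The dual equivalence operator `𝔡_i` for `i ∈ ℤ`. -/
def dOp (i : ℤ) (T : STab) : STab :=
  if ¬(1 ≤ i + 2 ∧ i + 2 ≤ (T.flatten.length : ℤ)) then T
  else if i = -1 then togglePos T 0 0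
  else if i = 0 then togglePos T 0 1
  else
    let w := shword T
    if btwn (idxOfZ i w) (idxOfZ (i + 2) w) (idxOfZ (i + 1) w) then sOp i T
    else if btwn (idxOfZ (i + 1) w) (idxOfZ i w) (idxOfZ (i + 2) w) then sOp (i + 1) T
    else T

/-! ## Marked cycles -/

/-- The 2-cycles of `z`, as ordered pairs `(i, j)` with `i < j = z(i)`. -/
def cycSet (z : Equiv.Perm ℤ) : Set (ℤ × ℤ) := {p | p.1 < p.2 ∧ z p.1 = p.2}

/-- `s_{a_n} ⋯ s_{a_{k+2}} s_{a_{k+1}}` (ordinary product; 0-based index `k`). -/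
def suffixPerm (a : List ℤ) (k : ℕ) : Equiv.Perm ℤ :=
  ((a.drop (k + 1)).reverse.map sPerm).prod

/-- `γ_{k+1}(a)` as an ordered pair (junk value `(0,0)` off the commutation set). -/
def gammaPair (a : List ℤ) (k : ℕ) : ℤ × ℤ :=
  match a[k]? with
  | some x => (min (suffixPerm a k x) (suffixPerm a k (x + 1)),
               max (suffixPerm a k x) (suffixPerm a k (x + 1)))
  | none => (0, 0)
/-! ## Increasing factorization sequences and Schur Q-functions -/

/-- `Incr_∞(R_inv^+(z))`: sequences of weakly increasing primed words, all but
finitely many empty, whose concatenation is a primed involution word for `z`. -/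
def IncrSeq (z : Equiv.Perm ℤ) : Set (ℕ → PWord) :=
  {φ | (∀ n, List.Chain' (· ≤ ·) (φ n)) ∧
    ∃ N, (∀ n, N ≤ n → φ n = []) ∧ ((List.range N).map φ).flatten ∈ RinvPlus z}

/-- Least bound past which a sequence of words is empty. -/
noncomputable def seqBound (φ : ℕ → PWord) : ℕ := sInf {N | ∀ n, N ≤ n → φ n = []}

/-- The concatenation `a^1 a^2 ⋯` of a sequence of words. -/
noncomputable def concatSeq (φ : ℕ → PWord) : PWord :=
  ((List.range (seqBound φ)).map φ).flatten

/-- `ℓ(a^1) + ⋯ + ℓ(a^i)`. -/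
def prefLen (φ : ℕ → PWord) (i : ℕ) : ℕ := (((List.range i).map φ).map List.length).sum

/-- The minimal `i ≥ 1` with `j ≤ ℓ(a^1) + ⋯ + ℓ(a^i)`. -/
noncomputable def relabel (φ : ℕ → PWord) (j : ℤ) : ℤ :=
  ((sInf {i : ℕ | 1 ≤ i ∧ j ≤ (prefLen φ i : ℤ)} : ℕ) : ℤ)

/-- The semistandard recording tableau `Q_EGᴼ(φ)`. -/
noncomputable def QEGseq (φ : ℕ → PWord) : STab :=
  (QEG (concatSeq φ)).map (List.map (fun x => (⟨relabel φ x.ceil, x.primed⟩ : Letter)))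

/-- The insertion tableau `P_EGᴼ(φ)`. -/
noncomputable def PEGseq (φ : ℕ → PWord) : STab := PEG (concatSeq φ)

/-- The Schur Q-function of a strict partition: the coefficient of the monomial with
exponent vector `d` is the number of semistandard shifted tableaux `T` of the given
shape with `x^T = x^d`. -/
noncomputable def SchurQ (sh : List ℕ) : MvPowerSeries ℤ ℤ :=
  fun d => (({T : STab | shapeOf T = sh ∧ IsSemistandard T ∧
    ∀ i : ℤ, d i = T.flatten.countP (fun x => decide (x.ceil = i))} : Set STab).ncard : ℤ)

/-- `Q_z = Σ_{φ ∈ Incr_∞(R_inv^+(z))} x^φ`. -/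
noncomputable def Qz (z : Equiv.Perm ℤ) : MvPowerSeries ℤ ℤ :=
  fun d => (({φ : ℕ → PWord | φ ∈ IncrSeq z ∧
    (∀ i : ℕ, d ((i : ℤ) + 1) = (φ i).length) ∧
    (∀ j : ℤ, j ≤ 0 → d j = 0)} : Set (ℕ → PWord)).ncard : ℤ)

/-! ## Dominant involutions -/

/-- The shifted diagram `SD_λ ⊆ ℤ × ℤ` of a strict partition. -/
def SDset (sh : List ℕ) : Set (ℤ × ℤ) :=
  {p | ∃ i j : ℕ, 1 ≤ i ∧ i ≤ sh.length ∧ 1 ≤ j ∧ j ≤ sh.getD (i - 1) 0 ∧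
    p.1 = (i : ℤ) ∧ p.2 = (i : ℤ) + (j : ℤ) - 1}

/-- The involution Rothe diagram `D̂(z) = {(i,j) : z(i) > j ≤ i < z(j)}`. -/
def invRothe (z : Equiv.Perm ℤ) : Set (ℤ × ℤ) :=
  {p | p.2 < z p.1 ∧ p.2 ≤ p.1 ∧ p.1 < z p.2}

/-- The tableau `T_λ` with entry `i + j - 1` in box `(i, j)` of `SD_λ`. -/
def Tlam (sh : List ℕ) : STab :=
  (List.range sh.length).map (fun r =>
    (List.range (sh.getD r 0)).map (fun k =>
      (⟨2 * (r : ℤ) + (k : ℤ) + 1, false⟩ : Letter)))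

/-- The permutation `i + m ↦ w(i) + m` (fixing everything outside `m + support`). -/
def shiftPerm (m : ℕ) (w : Equiv.Perm ℤ) : Equiv.Perm ℤ :=
  (Equiv.addLeft (m : ℤ)).permCongr w

/-- `z ∈ S_m`: `z` fixes every point outside `[1, m]`. -/
def SupportedOn (z : Equiv.Perm ℤ) (m : ℕ) : Prop :=
  ∀ x : ℤ, x < 1 ∨ (m : ℤ) < x → z x = x
/-! ## Primed compatible sequences -/

/-- A primed compatible sequence, recorded as the list of its columns `(index; value)`. -/
def IsPrimedCompatible (φ : List (ℕ × Letter)) : Prop :=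
  (∀ p ∈ φ, 0 < p.1 ∧ 0 < p.2.ceil) ∧
  List.Chain' (fun p q : ℕ × Letter => p.1 ≤ q.1 ∧ (p.1 = q.1 → p.2 ≤ q.2)) φ ∧
  (∀ (k l : ℕ) (p : ℕ × Letter), k < l → φ[k]? = some p → φ[l]? = some p →
    p.2.primed = false)

def IsIndexStrict (φ : List (ℕ × Letter)) : Prop :=
  List.Chain' (fun p q : ℕ × Letter => p.1 < q.1) φ

/-! ## Sagan–Worley insertion (orthogonal and symplectic versions) -/

/-- Whether `u` bumps `v`: strict comparison when inserting an unprimed letter into a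
row or a primed letter into a column, weak comparison otherwise. -/
def swBump (isRow : Bool) (u v : Letter) : Bool :=
  if (isRow && !u.primed) || (!isRow && u.primed) then decide (u < v) else decide (u ≤ v)

/-- Column stage of orthogonal Sagan–Worley insertion. -/
def swColO : ℕ → STab → ℕ → Letter → STab × Bool
  | 0, T, _, _ => (T, true)
  | fuel + 1, T, c, u =>
    let occ := (List.range (c + 1)).filterMap (fun r => (entry? T r c).map (fun x => (r, x)))
    match occ.find? (fun p => swBump false u p.2) with
    | none =>
        let r := occ.length
        let u' := if r = c ∧ u.primed then Letter.unprime u else u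
        (setRowG T r ((T.getD r []) ++ [u']), true)
    | some p =>
        if p.1 = c then
          if u.ceil = p.2.ceil then swColO fuel T (c + 1) (Letter.unprime p.2)
          else
            let q := switchPrimes u p.2
            swColO fuel (setEntryG T p.1 c q.1) (c + 1) q.2
        else swColO fuel (setEntryG T p.1 c u) (c + 1) p.2

/-- Row stage of orthogonal Sagan–Worley insertion. -/
def swRowO : ℕ → STab → ℕ → Letter → STab × Bool
  | 0, T, _, _ => (T, true)
  | fuel + 1, T, r, u =>
    let row := T.getD r []
    match row.findIdx? (fun v => swBump true u v) with
    | none =>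
        if row.isEmpty ∧ u.primed then (setRowG T r [Letter.unprime u], true)
        else (setRowG T r (row ++ [u]), false)
    | some k =>
        let v := row.getD k default
        if k = 0 then
          if u.ceil = v.ceil then swColO fuel T (r + 1) (Letter.unprime v)
          else
            let q := switchPrimes u v
            swColO fuel (setRowG T r (row.set 0 q.1)) (r + 1) q.2
        else swRowO fuel (setRowG T r (row.set k u)) (r + 1) v

def swInsertO (T : STab) (u : Letter) : STab × Bool :=
  swRowO (T.flatten.length + T.length + 2) T 0 u

/-- Column stage of symplectic (original) Sagan–Worley insertion. -/
def swColSp : ℕ → STab → ℕ → Letter → STab × Bool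
  | 0, T, _, _ => (T, true)
  | fuel + 1, T, c, u =>
    let occ := (List.range (c + 1)).filterMap (fun r => (entry? T r c).map (fun x => (r, x)))
    match occ.find? (fun p => swBump false u p.2) with
    | none => (setRowG T occ.length ((T.getD occ.length []) ++ [u]), true)
    | some p =>
        if p.1 = c then
          if u.ceil = p.2.ceil then swColSp fuel T (c + 1) (Letter.unprime p.2)
          else swColSp fuel (setEntryG T p.1 c u) (c + 1) p.2
        else swColSp fuel (setEntryG T p.1 c u) (c + 1) p.2

/-- Row stage of symplectic (original) Sagan–Worley insertion. -/
def swRowSp : ℕ → STab → ℕ → Letter → STab × Bool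
  | 0, T, _, _ => (T, true)
  | fuel + 1, T, r, u =>
    let row := T.getD r []
    match row.findIdx? (fun v => swBump true u v) with
    | none => (setRowG T r (row ++ [u]), false)
    | some k =>
        let v := row.getD k default
        if k = 0 then
          if u.ceil = v.ceil then swColSp fuel T (r + 1) (Letter.unprime v)
          else swColSp fuel (setRowG T r (row.set 0 u)) (r + 1) v
        else swRowSp fuel (setRowG T r (row.set k u)) (r + 1) v

def swInsertSp (T : STab) (u : Letter) : STab × Bool :=
  swRowSp (T.flatten.length + T.length + 2) T 0 u

def PSWO (φ : List (ℕ × Letter)) : STab := φ.foldl (fun T p => (swInsertO T p.2).1) []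

def PSWSp (φ : List (ℕ × Letter)) : STab := φ.foldl (fun T p => (swInsertSp T p.2).1) []

def QSWaux (ins : STab → Letter → STab × Bool) : STab → STab → List (ℕ × Letter) → STab
  | _, Q, [] => Q
  | P, Q, p :: rest =>
      let res := ins P p.2
      QSWaux ins res.1 (addBox Q P res.1 ⟨(p.1 : ℤ), res.2⟩) rest

def QSWO (φ : List (ℕ × Letter)) : STab := QSWaux swInsertO [] [] φ

def QSWSp (φ : List (ℕ × Letter)) : STab := QSWaux swInsertSp [] [] φ

/-- Entry `A_{ij}` of the circled matrix of `φ` (forgetting the circles). -/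
def cmEntry (φ : List (ℕ × Letter)) (i j : ℕ) : ℕ :=
  φ.countP (fun p => decide (p.1 = i ∧ p.2.ceil = (j : ℤ)))

/-! ## Shifted mixed insertion (orthogonal and symplectic versions) -/

/-- Tableaux whose entries are signed letters `(ε, u)`, `ε ∈ {+, -}`
(`true` records the sign `-`). -/
abbrev MTab := List (List (Bool × Letter))

def extractO (U : MTab) : STab :=
  U.map (fun row =>
    match row with
    | [] => []
    | (e, x) :: rest => (if e then (⟨x.ceil, true⟩ : Letter) else x) :: rest.map Prod.snd)

def extractSp (U : MTab) : STab := U.map (List.map Prod.snd)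

/-- One mixed insertion, of the pair `β` into row (`isCol = false`) or column
(`isCol = true`) number `idx`; returns the tableau and the added box. -/
def hmIns (sympl : Bool) : ℕ → MTab → Bool → ℕ → Bool × Letter → MTab × (ℕ × ℕ)
  | 0, T, _, _, _ => (T, (0, 0))
  | fuel + 1, T, isCol, idx, β =>
    if isCol then
      let c := idx
      let occ := (List.range (c + 1)).filterMap
        (fun r => (entryG? T r c).map (fun x => (r, x)))
      match occ.find? (fun p => decide (β.2 < p.2.2)) with
      | none =>
          let r := occ.length
          (setRowG T r ((T.getD r []) ++ [β]), (r, c))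
      | some p =>
          if p.1 = c then
            hmIns sympl fuel
              (setEntryG T p.1 c (if sympl then (p.2.1, β.2) else β)) true (c + 1)
              (if sympl then (β.1, ⟨p.2.2.ceil, true⟩) else (p.2.1, ⟨p.2.2.ceil, true⟩))
          else
            hmIns sympl fuel (setEntryG T p.1 c (p.2.1, β.2)) p.2.2.primed
              (if p.2.2.primed then c + 1 else p.1 + 1) (β.1, p.2.2)
    else
      let r := idx
      let row := T.getD r []
      match row.findIdx? (fun p => decide (β.2 < p.2)) with
      | none => (setRowG T r (row ++ [β]), (r, r + row.length))
      | some k =>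
          let q := row.getD k default
          if k = 0 then
            hmIns sympl fuel
              (setRowG T r (row.set 0 (if sympl then (q.1, β.2) else β))) true (r + 1)
              (if sympl then (β.1, ⟨q.2.ceil, true⟩) else (q.1, ⟨q.2.ceil, true⟩))
          else
            hmIns sympl fuel (setRowG T r (row.set k (q.1, β.2))) q.2.primed
              (if q.2.primed then r + k + 1 else r + 1) (β.1, q.2)

def hmInsert (sympl : Bool) (T : MTab) (x : Letter) : MTab × (ℕ × ℕ) :=
  hmIns sympl (2 * T.flatten.length + 4) T false 0 (x.primed, ⟨x.ceil, false⟩)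

def hmAuxCS (sympl : Bool) : MTab → STab → List (ℕ × Letter) → MTab × STab
  | U, Q, [] => (U, Q)
  | U, Q, p :: rest =>
      let res := hmInsert sympl U p.2
      let pos := res.2
      let sgn := ((entryG? res.1 pos.1 pos.2).map Prod.fst).getD false
      let pr : Bool := if sympl then sgn else (decide (pos.1 ≠ pos.2) && sgn)
      hmAuxCS sympl res.1
        (setRowG Q pos.1 ((Q.getD pos.1 []) ++ [(⟨(p.1 : ℤ), pr⟩ : Letter)])) rest

def PHMO (φ : List (ℕ × Letter)) : STab := extractO (hmAuxCS false [] [] φ).1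
def QHMO (φ : List (ℕ × Letter)) : STab := (hmAuxCS false [] [] φ).2
def PHMSp (φ : List (ℕ × Letter)) : STab := extractSp (hmAuxCS true [] [] φ).1
def QHMSp (φ : List (ℕ × Letter)) : STab := (hmAuxCS true [] [] φ).2

/-- A primed word, identified with the primed compatible sequence with
index row `1, 2, …, n`. -/
def wordCS (a : PWord) : List (ℕ × Letter) :=
  ((List.range a.length).zip a).map (fun p => (p.1 + 1, p.2))

/-! ## The transpose of a primed compatible sequence -/

def insSortedCS (p : ℕ × Letter) : List (ℕ × Letter) → List (ℕ × Letter)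
  | [] => [p]
  | q :: rest =>
      if p.1 < q.1 ∨ (p.1 = q.1 ∧ p.2 ≤ q.2) then p :: q :: rest
      else q :: insSortedCS p rest

def sortCS (l : List (ℕ × Letter)) : List (ℕ × Letter) := l.foldr insSortedCS []

/-- `φ^⊤`: move each prime from the value to the index above it, interchange the two
rows, and reorder the columns lexicographically. -/
def transposeCS (φ : List (ℕ × Letter)) : List (ℕ × Letter) :=
  sortCS (φ.map (fun p => (p.2.ceil.toNat, (⟨(p.1 : ℤ), p.2.primed⟩ : Letter))))

/-! ## Codes of letters -/

/-- An order embedding of the primed alphabet into `ℤ`, sending `i` to `2i` and `i'` to `2i-1`. -/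
def Letter.code (x : Letter) : ℤ := 2 * x.ceil - if x.primed then 1 else 0

theorem Letter.lt_iff_code {x y : Letter} : x < y ↔ x.code < y.code := by
  have h : x < y ↔ toLex (x.ceil, !x.primed) < toLex (y.ceil, !y.primed) := Iff.rfl
  rw [h, Prod.Lex.toLex_lt_toLex]
  obtain ⟨a, p⟩ := x
  obtain ⟨b, q⟩ := y
  simp only [Letter.code]
  cases p <;> cases q <;> simp [Bool.lt_iff]
  all_goals omega

theorem Letter.le_iff_code {x y : Letter} : x ≤ y ↔ x.code ≤ y.code := by
  rw [← not_lt, ← not_lt, Letter.lt_iff_code]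

theorem Letter.code_injective : Function.Injective Letter.code := by
  rintro ⟨a, p⟩ ⟨b, q⟩ h
  cases p <;> cases q <;> simp [Letter.code] at h ⊢ <;> omega

theorem Letter.primed_iff_code (x : Letter) : x.primed = true ↔ x.code % 2 = 1 := by
  obtain ⟨a, p⟩ := x
  cases p <;> simp [Letter.code]

theorem Letter.unprimed_iff_code (x : Letter) : x.primed = false ↔ x.code % 2 = 0 := by
  obtain ⟨a, p⟩ := x
  cases p <;> simp [Letter.code]

theorem Letter.ceil_eq_code (x : Letter) : x.ceil = (x.code + 1) / 2 := by
  obtain ⟨a, p⟩ := x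
  cases p <;> simp [Letter.code]
  omega

theorem Letter.code_mk_true (a : ℤ) : (⟨a, true⟩ : Letter).code = 2 * a - 1 := by
  simp [Letter.code]

theorem Letter.code_mk_false (a : ℤ) : (⟨a, false⟩ : Letter).code = 2 * a := by
  simp [Letter.code]

/-! ## Entries of lists of rows -/

section Entries

variable {α β : Type*}

/-- No row of `T` is empty. -/
def NoEmptyRow (T : List (List α)) : Prop := ∀ row ∈ T, row ≠ []

@[simp] theorem entryG?_nil (r c : ℕ) : entryG? ([] : List (List α)) r c = none := by
  simp [entryG?]

@[simp] theorem entryG?_cons_zero (row : List α) (T : List (List α)) (c : ℕ) :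
    entryG? (row :: T) 0 c = row[c]? := by
  simp [entryG?]

@[simp] theorem entryG?_succ_zero (T : List (List α)) (r : ℕ) : entryG? T (r + 1) 0 = none := by
  simp [entryG?]

@[simp] theorem entryG?_cons_succ (row : List α) (T : List (List α)) (r c : ℕ) :
    entryG? (row :: T) (r + 1) (c + 1) = entryG? T r c := by
  simp [entryG?]

theorem entryG?_of_lt (T : List (List α)) {r c : ℕ} (h : c < r) : entryG? T r c = none := by
  simp [entryG?, h]

theorem entryG?_getD (T : List (List α)) {r c : ℕ} (h : r ≤ c) :
    entryG? T r c = (T.getD r [])[c - r]? := by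
  simp only [entryG?, h, if_true, List.getD_eq_getElem?_getD]
  cases T[r]? <;> simp

theorem NoEmptyRow.ext {T T' : List (List α)} (hT : NoEmptyRow T) (hT' : NoEmptyRow T')
    (h : ∀ r c, entryG? T r c = entryG? T' r c) : T = T' := by
  induction T generalizing T' with
  | nil =>
    cases T' with
    | nil => rfl
    | cons row T' =>
      have := h 0 0
      have h2 := hT' row (by simp)
      cases row <;> simp_all
  | cons row T ih =>
    cases T' with
    | nil =>
      have h1 := h 0 0
      have h2 := hT row (by simp)
      simp only [entryG?_cons_zero, entryG?_nil, List.getElem?_eq_none_iff] at h1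
      exact absurd (List.length_eq_zero_iff.1 (Nat.le_zero.1 h1)) h2
    | cons row' T' =>
      have h1 : row = row' := by
        apply List.ext_getElem?
        intro i
        simpa using h 0 i
      have h2 : T = T' := by
        apply ih
        · exact fun x hx => hT x (by simp [hx])
        · exact fun x hx => hT' x (by simp [hx])
        · intro r c
          simpa using h (r + 1) (c + 1)
      rw [h1, h2]

theorem exists_list_of_fun (N : ℕ) (g : ℕ → Option α) (hg : ∀ c, g (c + 1) ≠ none → g c ≠ none)
    (hN : ∀ c, N ≤ c → g c = none) : ∃ l : List α, ∀ c, l[c]? = g c := by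
  induction N generalizing g with
  | zero => exact ⟨[], fun c => by simp [hN c (Nat.zero_le c)]⟩
  | succ N ih =>
    cases h0 : g 0 with
    | none =>
      refine ⟨[], fun c => ?_⟩
      have : ∀ c, g c = none := by
        intro c
        induction c with
        | zero => exact h0
        | succ c ihc =>
          by_contra h
          exact hg c h ihc
      simp [this]
    | some x =>
      obtain ⟨l, hl⟩ := ih (fun c => g (c + 1)) (fun c => hg (c + 1))
        (fun c hc => hN (c + 1) (by omega))
      refine ⟨x :: l, fun c => ?_⟩
      cases c with
      | zero => simp [h0]
      | succ c => simpa using hl c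

/-- A function on boxes whose support is a finite shifted diagram. -/
structure IsShape (F : ℕ → ℕ → Option α) : Prop where
  lower : ∀ r c, c < r → F r c = none
  left : ∀ r c, r ≤ c → F r (c + 1) ≠ none → F r c ≠ none
  below : ∀ r c, r < c → F (r + 1) c ≠ none → F r c ≠ none
  bounded : ∃ N, ∀ r c, N ≤ c → F r c = none

theorem IsShape.exists_rows {F : ℕ → ℕ → Option α} (hF : IsShape F) :
    ∃ T : List (List α), NoEmptyRow T ∧ ∀ r c, entryG? T r c = F r c := by
  obtain ⟨N, hN⟩ := hF.bounded
  induction N generalizing F with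
  | zero => exact ⟨[], by simp [NoEmptyRow], fun r c => by simp [hN r c (Nat.zero_le c)]⟩
  | succ N ih =>
    obtain ⟨l, hl⟩ := exists_list_of_fun (N + 1) (F 0) (fun c => hF.left 0 c (Nat.zero_le c))
      (fun c hc => hN 0 c hc)
    obtain ⟨T, hT, hTF⟩ := ih (F := fun r c => F (r + 1) (c + 1))
      ⟨fun r c h => hF.lower _ _ (by omega), fun r c h => hF.left _ _ (by omega),
        fun r c h => hF.below _ _ (by omega), ⟨N, fun r c h => hN _ _ (by omega)⟩⟩
      (fun r c h => hN _ _ (by omega))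
    cases h0 : F 0 0 with
    | none =>
      have hrow : ∀ c, F 0 c = none := by
        intro c
        induction c with
        | zero => exact h0
        | succ c ihc =>
          by_contra h
          exact hF.left 0 c (Nat.zero_le c) h ihc
      refine ⟨[], by simp [NoEmptyRow], fun r => ?_⟩
      induction r with
      | zero => intro c; simp [hrow]
      | succ r ihr =>
        intro c
        by_contra h
        rcases Nat.lt_or_ge r c with hc | hc
        · exact hF.below r c hc (by simpa [eq_comm] using h) (by simpa [eq_comm] using ihr c)
        · exact h (by simp [hF.lower (r + 1) c (by omega)])
    | some x =>
      refine ⟨l :: T, ?_, fun r c => ?_⟩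
      · intro row hrow
        rcases List.mem_cons.1 hrow with rfl | h
        · rintro rfl
          have := hl 0
          simp [h0] at this
        · exact hT row h
      · cases r with
        | zero => simpa using hl c
        | succ r =>
          cases c with
          | zero => simp [hF.lower (r + 1) 0 (by omega)]
          | succ c => simpa using hTF r c

theorem entryG?_setRowG (T : List (List α)) {r : ℕ} (hr : r ≤ T.length) (row : List α)
    (i j : ℕ) : entryG? (setRowG T r row) i j =
      if i = r then (if r ≤ j then row[j - r]? else none) else entryG? T i j := by
  unfold setRowG entryG?
  by_cases h : r < T.length
  · simp only [h, if_true, List.getElem?_set]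
    by_cases hi : i = r
    · subst hi; simp
    · simp [hi, Ne.symm hi]
  · have hr' : r = T.length := by omega
    subst hr'
    simp only [lt_irrefl, if_false]
    by_cases hi : i = T.length
    · subst hi; simp
    · rcases Nat.lt_or_ge i T.length with h1 | h1
      · simp [hi, List.getElem?_append_left h1]
      · have h2 : T.length + 1 ≤ i := by omega
        simp [hi, List.getElem?_eq_none h1, List.getElem?_append_right h1]
        intro _ 
        have : i - T.length ≠ 0 := by omega
        cases hh : i - T.length with
        | zero => omega
        | succ n => simp

theorem NoEmptyRow.setRowG {T : List (List α)} (hT : NoEmptyRow T) (r : ℕ) {row : List α}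
    (hrow : row ≠ []) : NoEmptyRow (setRowG T r row) := by
  intro x hx
  unfold _root_.setRowG at hx
  split_ifs at hx
  · rcases List.mem_or_eq_of_mem_set hx with h | h
    · exact hT x h
    · rwa [h]
  · rcases List.mem_append.1 hx with h | h
    · exact hT x h
    · simp at h; rwa [h]

/-- Replace the value of `F` in box `(r, c)`. -/
def updBox (F : ℕ → ℕ → Option α) (r c : ℕ) (v : Option α) : ℕ → ℕ → Option α :=
  fun i j => if i = r ∧ j = c then v else F i j

@[simp] theorem updBox_self (F : ℕ → ℕ → Option α) (r c : ℕ) (v : Option α) :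
    updBox F r c v r c = v := by simp [updBox]

theorem updBox_of_ne (F : ℕ → ℕ → Option α) {r c i j : ℕ} (v : Option α)
    (h : ¬(i = r ∧ j = c)) : updBox F r c v i j = F i j := by simp [updBox, h]

theorem updBox_updBox (F : ℕ → ℕ → Option α) (r c : ℕ) (v w : Option α) :
    updBox (updBox F r c v) r c w = updBox F r c w := by
  funext i j
  by_cases h : i = r ∧ j = c <;> simp [updBox, h]

theorem updBox_eq_self {F : ℕ → ℕ → Option α} {r c : ℕ} {v : Option α} (h : F r c = v) :
    updBox F r c v = F := by
  funext i j
  by_cases h' : i = r ∧ j = c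
  · obtain ⟨rfl, rfl⟩ := h'; simp [h]
  · simp [updBox, h']

/-- Appending an entry at the end of a row fills the corresponding box. -/
theorem entryG?_append_row (T : List (List α)) {r c : ℕ} (hr : r ≤ T.length)
    (hrc : r + (T.getD r []).length = c) (x : α) :
    entryG? (setRowG T r (T.getD r [] ++ [x])) = updBox (entryG? T) r c (some x) := by
  funext i j
  rw [entryG?_setRowG T hr]
  by_cases hi : i = r
  · subst hi
    simp only [if_true, updBox, true_and]
    by_cases hj : j = c
    · subst hj
      simp [← hrc]
    · by_cases hij : i ≤ j
      · simp only [hij, hj, if_true, if_false]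
        rw [entryG?_getD T hij]
        rcases Nat.lt_or_ge (j - i) (T.getD i []).length with h | h
        · rw [List.getElem?_append_left h]
        · rw [List.getElem?_append_right h, List.getElem?_eq_none h]
          have : j - i - (T.getD i []).length ≠ 0 := by omega
          cases hh : j - i - (T.getD i []).length with
          | zero => omega
          | succ n => simp
      · simp [hij, hj, entryG?_of_lt T (not_le.1 hij)]
  · simp [hi, updBox]

theorem entryG?_set_row (T : List (List α)) {r k : ℕ} (hk : k < (T.getD r []).length) (x : α) :
    entryG? (setRowG T r ((T.getD r []).set k x)) = updBox (entryG? T) r (r + k) (some x) := by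
  have hr : r < T.length := by
    by_contra h
    simp [List.getD_eq_getElem?_getD, List.getElem?_eq_none (not_lt.1 h)] at hk
  funext i j
  rw [entryG?_setRowG T hr.le]
  by_cases hi : i = r
  · subst hi
    simp only [if_true, updBox, true_and]
    by_cases hij : i ≤ j
    · rw [entryG?_getD T hij, List.getElem?_set]
      by_cases hj : j = i + k
      · subst hj
        simpa [List.getD_eq_getElem?_getD] using hk
      · have : k ≠ j - i := by omega
        simp [hij, hj, this]
    · have : j ≠ i + k := by omega
      simp [hij, this, entryG?_of_lt T (not_le.1 hij)]
  · simp [hi, updBox]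

theorem setEntryG_eq_setRowG (T : List (List α)) {r c : ℕ} (h : r < T.length) (x : α) :
    setEntryG T r c x = setRowG T r ((T.getD r []).set (c - r) x) := by
  simp [setEntryG, setRowG, h]

theorem lt_length_of_entryG?_ne_none {T : List (List α)} {r c : ℕ} (h : entryG? T r c ≠ none) :
    r ≤ c ∧ r < T.length ∧ c - r < (T.getD r []).length := by
  have hrc : r ≤ c := by
    by_contra h'
    exact h (entryG?_of_lt T (not_le.1 h'))
  rw [entryG?_getD T hrc] at h
  have h2 : c - r < (T.getD r []).length := by
    by_contra h'
    exact h (List.getElem?_eq_none (not_lt.1 h'))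
  refine ⟨hrc, ?_, h2⟩
  by_contra h'
  simp [List.getD_eq_getElem?_getD, List.getElem?_eq_none (not_lt.1 h')] at h

theorem entryG?_setEntryG (T : List (List α)) {r c : ℕ} (h : entryG? T r c ≠ none) (x : α) :
    entryG? (setEntryG T r c x) = updBox (entryG? T) r c (some x) := by
  obtain ⟨h1, h2, h3⟩ := lt_length_of_entryG?_ne_none h
  rw [setEntryG_eq_setRowG T h2, entryG?_set_row T h3]
  congr 1
  omega

theorem NoEmptyRow.setEntryG {T : List (List α)} (hT : NoEmptyRow T) {r c : ℕ}
    (h : entryG? T r c ≠ none) (x : α) : NoEmptyRow (setEntryG T r c x) := by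
  obtain ⟨h1, h2, h3⟩ := lt_length_of_entryG?_ne_none h
  rw [setEntryG_eq_setRowG T h2]
  apply hT.setRowG
  intro h4
  have := congrArg List.length h4
  simp at this
  simp [this] at h3

theorem entryG?_map (T : List (List α)) (f : α → β) (r c : ℕ) :
    entryG? (T.map (List.map f)) r c = (entryG? T r c).map f := by
  unfold entryG?
  split_ifs
  · simp only [List.getElem?_map]
    cases T[r]? <;> simp
  · rfl

/-- Counting entries of a list of rows by their boxes. -/
theorem countP_flatten_eq_ncard (T : List (List α)) (p : α → Bool) :
    T.flatten.countP p = {b : ℕ × ℕ | ∃ x, entryG? T b.1 b.2 = some x ∧ p x = true}.ncard ∧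
    {b : ℕ × ℕ | ∃ x, entryG? T b.1 b.2 = some x ∧ p x = true}.Finite := by
  have hrow : ∀ l : List α, l.countP p = {k : ℕ | ∃ x, l[k]? = some x ∧ p x = true}.ncard ∧
      {k : ℕ | ∃ x, l[k]? = some x ∧ p x = true}.Finite := by
    intro l
    induction l with
    | nil => simp
    | cons a l ih =>
      have hs : {k : ℕ | ∃ x, (a :: l)[k]? = some x ∧ p x = true} =
          (if p a then {0} else ∅) ∪ Nat.succ '' {k : ℕ | ∃ x, l[k]? = some x ∧ p x = true} := by
        ext k
        cases k with
        | zero => cases hp : p a <;> simp [hp]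
        | succ k => cases hp : p a <;> simp
      have hf : (if p a = true then ({0} : Set ℕ) else ∅).Finite := by split_ifs <;> simp
      rw [hs, Set.ncard_union_eq _ hf (ih.2.image _),
        Set.ncard_image_of_injective _ Nat.succ_injective, ← ih.1]
      · refine ⟨?_, hf.union (ih.2.image _)⟩
        cases hp : p a <;> simp [hp]
        omega
      · cases hp : p a <;> simp
  induction T with
  | nil => simp
  | cons row T ih =>
    have hs : {b : ℕ × ℕ | ∃ x, entryG? (row :: T) b.1 b.2 = some x ∧ p x = true} =
        (fun k => ((0, k) : ℕ × ℕ)) '' {k : ℕ | ∃ x, row[k]? = some x ∧ p x = true} ∪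
        (fun b : ℕ × ℕ => (b.1 + 1, b.2 + 1)) ''
          {b : ℕ × ℕ | ∃ x, entryG? T b.1 b.2 = some x ∧ p x = true} := by
      ext ⟨r, c⟩
      cases r with
      | zero => simp
      | succ r =>
        cases c with
        | zero => simp
        | succ c => simp
    have hi1 : Function.Injective (fun k => ((0, k) : ℕ × ℕ)) := by
      intro a b h; simpa using h
    have hi2 : Function.Injective (fun b : ℕ × ℕ => (b.1 + 1, b.2 + 1)) := by
      rintro ⟨a, b⟩ ⟨c, d⟩ h; simpa using h
    obtain ⟨h1, h2⟩ := hrow row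
    rw [hs, Set.ncard_union_eq _ (h2.image _) (ih.2.image _),
      Set.ncard_image_of_injective _ hi1, Set.ncard_image_of_injective _ hi2, ← ih.1, ← h1]
    · refine ⟨by simp, (h2.image _).union (ih.2.image _)⟩
    · rw [Set.disjoint_left]
      rintro _ ⟨a, _, rfl⟩ ⟨b, _, h⟩
      simp at h

theorem mem_flatten_iff_entryG? (T : List (List α)) (x : α) :
    x ∈ T.flatten ↔ ∃ r c, entryG? T r c = some x := by
  induction T with
  | nil => simp
  | cons row T ih =>
    rw [List.flatten_cons, List.mem_append, ih, List.mem_iff_getElem?]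
    constructor
    · rintro (⟨i, h⟩ | ⟨r, c, h⟩)
      · exact ⟨0, i, by simpa using h⟩
      · exact ⟨r + 1, c + 1, by simpa using h⟩
    · rintro ⟨r, c, h⟩
      cases r with
      | zero => exact Or.inl ⟨c, by simpa using h⟩
      | succ r =>
        cases c with
        | zero => simp at h
        | succ c => exact Or.inr ⟨r, c, by simpa using h⟩

theorem shapeOf_map (T : List (List α)) (f : α → β) :
    shapeOf (T.map (List.map f)) = shapeOf T := by
  simp [shapeOf, Function.comp_def]

theorem entryG?_ne_none_iff_shapeOf (T : List (List α)) (r c : ℕ) :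
    entryG? T r c ≠ none ↔ r ≤ c ∧ ∃ n, (shapeOf T)[r]? = some n ∧ c - r < n := by
  unfold entryG? shapeOf
  by_cases h : r ≤ c
  · simp only [h, if_true, true_and, List.getElem?_map]
    cases T[r]? <;> simp
  · simp [h]

theorem noEmptyRow_iff_shapeOf (T : List (List α)) : NoEmptyRow T ↔ ∀ m ∈ shapeOf T, 0 < m := by
  simp [NoEmptyRow, shapeOf, List.length_pos_iff]

theorem shapeOf_eq_iff {T : List (List α)} {T' : List (List β)} (hT : NoEmptyRow T)
    (hT' : NoEmptyRow T') :
    shapeOf T = shapeOf T' ↔ ∀ r c, (entryG? T r c ≠ none ↔ entryG? T' r c ≠ none) := by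
  constructor
  · intro h r c
    rw [entryG?_ne_none_iff_shapeOf, entryG?_ne_none_iff_shapeOf, h]
  · intro h
    rw [← shapeOf_map T (fun _ => ()), ← shapeOf_map T' (fun _ => ())]
    congr 1
    apply NoEmptyRow.ext
    · rw [noEmptyRow_iff_shapeOf, shapeOf_map, ← noEmptyRow_iff_shapeOf]; exact hT
    · rw [noEmptyRow_iff_shapeOf, shapeOf_map, ← noEmptyRow_iff_shapeOf]; exact hT'
    · intro r c
      rw [entryG?_map, entryG?_map]
      have := h r c
      cases h1 : entryG? T r c <;> cases h2 : entryG? T' r c <;> simp_all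

theorem entryG?_bounded (T : List (List α)) : ∃ N, ∀ r c, N ≤ c → entryG? T r c = none := by
  induction T with
  | nil => exact ⟨0, by simp⟩
  | cons row T ih =>
    obtain ⟨N, hN⟩ := ih
    refine ⟨row.length + N + 1, fun r c h => ?_⟩
    cases r with
    | zero => simp; omega
    | succ r =>
      cases c with
      | zero => simp
      | succ c => simpa using hN r c (by omega)

theorem isShifted_iff_isShape (T : List (List α)) :
    IsShifted T ↔ NoEmptyRow T ∧ IsShape (entryG? T) := by
  have key : List.IsChain (fun a b => b < a) (shapeOf T) ∧ NoEmptyRow T ↔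
      NoEmptyRow T ∧ ∀ r c, r < c → entryG? T (r + 1) c ≠ none → entryG? T r c ≠ none := by
    rw [and_comm]
    refine and_congr_right fun hT => ?_
    rw [List.isChain_iff_getElem]
    rw [noEmptyRow_iff_shapeOf] at hT
    constructor
    · intro h r c hrc h1
      rw [entryG?_ne_none_iff_shapeOf] at h1 ⊢
      obtain ⟨h2, n, h3, h4⟩ := h1
      obtain ⟨h5, rfl⟩ := List.getElem?_eq_some_iff.1 h3
      have := h r h5
      exact ⟨by omega, _, List.getElem?_eq_getElem (by omega), by omega⟩
    · intro h r hr
      have h1 := h r (r + (shapeOf T)[r + 1])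
      have h0 := hT _ (List.getElem_mem hr)
      rw [entryG?_ne_none_iff_shapeOf, entryG?_ne_none_iff_shapeOf] at h1
      obtain ⟨_, n, h3, h4⟩ := h1 (by omega)
        ⟨by omega, _, List.getElem?_eq_getElem hr, by omega⟩
      obtain ⟨h5, rfl⟩ := List.getElem?_eq_some_iff.1 h3
      omega
  unfold IsShifted IsStrictPartition
  rw [← noEmptyRow_iff_shapeOf]
  refine key.trans (and_congr_right fun hT => ⟨fun h => ⟨?_, ?_, h, entryG?_bounded T⟩,
    fun h => h.below⟩)
  · exact fun r c hrc => entryG?_of_lt T hrc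
  · intro r c hrc h1
    rw [entryG?_ne_none_iff_shapeOf] at h1 ⊢
    obtain ⟨_, n, h3, h4⟩ := h1
    exact ⟨hrc, n, h3, by omega⟩

end Entries

/-! ## Integer fillings of the infinite shifted quadrant

Odd numbers play the role of primed letters and even numbers that of unprimed letters. -/

/-- Semistandardness: rows and columns weakly increase, no odd number is repeated in a row and no
even number is repeated in a column. -/
structure WeakSemi (g : ℕ → ℕ → ℤ) : Prop where
  row : ∀ r c, r ≤ c → 2 * ((g r c + 1) / 2) ≤ g r (c + 1)
  col : ∀ r c, r < c → 2 * (g r c / 2) + 1 ≤ g (r + 1) c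

/-- Semistandardness with even entries on the main diagonal. -/
structure Semi (g : ℕ → ℕ → ℤ) : Prop extends WeakSemi g where
  diag : ∀ r, g r r % 2 = 0

theorem WeakSemi.row_mono {g : ℕ → ℕ → ℤ} (hg : WeakSemi g) {r c c' : ℕ} (hr : r ≤ c)
    (h : c ≤ c') : g r c ≤ g r c' := by
  induction c', h using Nat.le_induction with
  | base => exact le_rfl
  | succ n hn ih =>
    have := hg.row r n (by omega)
    omega

theorem WeakSemi.col_mono {g : ℕ → ℕ → ℤ} (hg : WeakSemi g) {r r' c : ℕ} (h : r ≤ r')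
    (hr : r' ≤ c) : g r c ≤ g r' c := by
  induction r', h using Nat.le_induction with
  | base => exact le_rfl
  | succ n hn ih =>
    have := hg.col n c (by omega)
    have := ih (by omega)
    omega

/-- Replace the value of `g` in box `(r, c)`. -/
def setBox (g : ℕ → ℕ → ℤ) (r c : ℕ) (u : ℤ) : ℕ → ℕ → ℤ :=
  fun i j => if i = r ∧ j = c then u else g i j

theorem Semi.setBox {g : ℕ → ℕ → ℤ} (hg : Semi g) {r c : ℕ} {w : ℤ}
    (hleft : ∀ j, r ≤ j → j + 1 = c → 2 * ((g r j + 1) / 2) ≤ w)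
    (hbelow : ∀ i, i + 1 = r → r ≤ c → 2 * (g i c / 2) + 1 ≤ w)
    (hright : r ≤ c → 2 * ((w + 1) / 2) ≤ g r (c + 1))
    (habove : r < c → 2 * (w / 2) + 1 ≤ g (r + 1) c) (hdiag : r = c → w % 2 = 0) :
    Semi (setBox g r c w) := by
  refine ⟨⟨fun i j hij => ?_, fun i j hij => ?_⟩, fun i => ?_⟩
  · have := hg.row i j hij
    unfold _root_.setBox
    split_ifs with h1 h2 h2
    · omega
    · obtain ⟨rfl, rfl⟩ := h1; exact hright hij
    · obtain ⟨rfl, h2⟩ := h2; exact hleft j hij h2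
    · exact this
  · have := hg.col i j hij
    unfold _root_.setBox
    split_ifs with h1 h2 h2
    · omega
    · obtain ⟨rfl, rfl⟩ := h1; exact habove hij
    · obtain ⟨h2, rfl⟩ := h2; exact hbelow i h2 (by omega)
    · exact this
  · have := hg.diag i
    unfold _root_.setBox
    split_ifs with h1
    · exact hdiag (by omega)
    · exact this

theorem Semi.setBox_of_le {g : ℕ → ℕ → ℤ} (hg : Semi g) {r c : ℕ} {w : ℤ} (hrc : r ≤ c)
    (hw : g r c ≤ w) (hright : 2 * ((w + 1) / 2) ≤ g r (c + 1))
    (habove : r < c → 2 * (w / 2) + 1 ≤ g (r + 1) c) (hdiag : r = c → w % 2 = 0) :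
    Semi (_root_.setBox g r c w) := by
  refine hg.setBox ?_ ?_ (fun _ => hright) habove hdiag
  · rintro j hj rfl
    have := hg.row r j hj
    omega
  · rintro i rfl hi
    have := hg.col i c hi
    omega

/-- `(r, c)` is the first box in row or column `idx` whose value exceeds `u`. -/
def FirstExceeds (g : ℕ → ℕ → ℤ) (isCol : Bool) (idx : ℕ) (u : ℤ) (r c : ℕ) : Prop :=
  r ≤ c ∧ u < g r c ∧
    if isCol then c = idx ∧ ∀ i < r, g i c ≤ u else r = idx ∧ ∀ j, r ≤ j → j < c → g r j ≤ u

/-- The number `v`, about to be inserted in row or column `idx`, may have been bumped from the box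
`(r, c)`. -/
def BumpedFrom (g : ℕ → ℕ → ℤ) (isCol : Bool) (idx : ℕ) (v : ℤ) (r c : ℕ) : Prop :=
  r ≤ c ∧ g r c < v ∧
    if isCol then v % 2 = 1 ∧ idx = c + 1 ∧ v < g r (c + 1) ∧ (r < c → v ≤ g (r + 1) c)
    else v % 2 = 0 ∧ idx = r + 1 ∧ r < c ∧ v ≤ g r (c + 1) ∧ v < g (r + 1) c

/-- Insertion of `v` in row or column `idx` is the first or an intermediate stage of mixed
insertion. -/
def Pending (g : ℕ → ℕ → ℤ) (isCol : Bool) (idx : ℕ) (v : ℤ) : Prop :=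
  (isCol = false ∧ idx = 0 ∧ v % 2 = 0) ∨ ∃ r c, BumpedFrom g isCol idx v r c

theorem FirstExceeds.unique {g : ℕ → ℕ → ℤ} {isCol : Bool} {idx : ℕ} {u : ℤ} {r c r' c' : ℕ}
    (h : FirstExceeds g isCol idx u r c) (h' : FirstExceeds g isCol idx u r' c') :
    r = r' ∧ c = c' := by
  unfold FirstExceeds at h h'
  cases isCol
  · simp only [Bool.false_eq_true, if_false] at h h'
    obtain ⟨h1, h2, rfl, h4⟩ := h
    obtain ⟨h1', h2', rfl, h4'⟩ := h'
    refine ⟨rfl, ?_⟩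
    rcases lt_trichotomy c c' with hc | hc | hc
    · have := h4' c h1 hc; omega
    · exact hc
    · have := h4 c' h1' hc; omega
  · simp only [if_true] at h h'
    obtain ⟨h1, h2, rfl, h4⟩ := h
    obtain ⟨h1', h2', rfl, h4'⟩ := h'
    refine ⟨?_, rfl⟩
    rcases lt_trichotomy r r' with hc | hc | hc
    · have := h4' r hc; omega
    · exact hc
    · have := h4 r' hc; omega

theorem BumpedFrom.unique {g : ℕ → ℕ → ℤ} (hg : WeakSemi g) {isCol : Bool} {idx : ℕ} {v : ℤ}
    {r c r' c' : ℕ} (h : BumpedFrom g isCol idx v r c) (h' : BumpedFrom g isCol idx v r' c') :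
    r = r' ∧ c = c' := by
  unfold BumpedFrom at h h'
  cases isCol
  · simp only [Bool.false_eq_true, if_false] at h h'
    obtain ⟨h1, h2, h3, h4, h5, h6, h7⟩ := h
    obtain ⟨h1', h2', h3', h4', h5', h6', h7'⟩ := h'
    obtain rfl : r = r' := by omega
    refine ⟨rfl, ?_⟩
    rcases lt_trichotomy c c' with hc | hc | hc
    · have := hg.row_mono (r := r) (c := c + 1) (c' := c') (by omega) hc; omega
    · exact hc
    · have := hg.row_mono (r := r) (c := c' + 1) (c' := c) (by omega) hc; omega
  · simp only [if_true] at h h'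
    obtain ⟨h1, h2, h3, h4, h5, h6⟩ := h
    obtain ⟨h1', h2', h3', h4', h5', h6'⟩ := h'
    obtain rfl : c = c' := by omega
    refine ⟨?_, rfl⟩
    rcases lt_trichotomy r r' with hc | hc | hc
    · have := hg.col_mono (r := r + 1) (r' := r') (c := c) hc h1'; have := h6 (by omega); omega
    · exact hc
    · have := hg.col_mono (r := r' + 1) (r' := r) (c := c) hc h1; have := h6' (by omega); omega

theorem Pending.parity {g : ℕ → ℕ → ℤ} {isCol : Bool} {idx : ℕ} {v : ℤ}
    (h : Pending g isCol idx v) : isCol = decide (v % 2 = 1) := by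
  rcases h with ⟨rfl, -, h⟩ | ⟨r, c, -, -, h⟩
  · simp; omega
  · cases isCol <;> simp at h ⊢ <;> omega

/-- Every intermediate insertion finds a box to act on. -/
theorem Pending.exists_firstExceeds {g : ℕ → ℕ → ℤ} {isCol : Bool} {idx : ℕ} {v : ℤ}
    (h : Pending g isCol idx v) (hv : ∃ c, v < g 0 c) : ∃ r c, FirstExceeds g isCol idx v r c := by
  have key : ∀ r, (∃ c, r ≤ c ∧ v < g r c) → ∃ c, FirstExceeds g false r v r c := by
    intro r hr
    classical
    have h1 := Nat.find_spec hr
    refine ⟨Nat.find hr, h1.1, h1.2, ?_⟩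
    simp only [Bool.false_eq_true, if_false, true_and]
    intro j hj hlt
    have := Nat.find_min hr hlt
    push Not at this
    exact this hj
  rcases h with ⟨rfl, rfl, -⟩ | ⟨r, c, h1, h2, h3⟩
  · obtain ⟨c, hc⟩ := hv
    exact ⟨0, key 0 ⟨c, by omega, hc⟩⟩
  · cases isCol
    · simp only [Bool.false_eq_true, if_false] at h3
      obtain ⟨h3, rfl, h5, h6, h7⟩ := h3
      exact ⟨_, key _ ⟨c, h5, h7⟩⟩
    · simp only [if_true] at h3
      obtain ⟨h3, rfl, h5, h6⟩ := h3
      classical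
      have hr : ∃ i, v < g i (c + 1) := ⟨r, h5⟩
      refine ⟨Nat.find hr, c + 1, ?_, Nat.find_spec hr, ?_⟩
      · have := Nat.find_min' hr h5
        omega
      · simp only [if_true, true_and]
        intro i hi
        simpa using Nat.find_min hr hi

/-- One bump of an intermediate insertion preserves semistandardness. -/
theorem Pending.semi_setBox {g : ℕ → ℕ → ℤ} (hg : Semi g) {isCol : Bool} {idx : ℕ} {u : ℤ}
    {r c : ℕ} (h : Pending g isCol idx u) (hf : FirstExceeds g isCol idx u r c) :
    Semi (setBox g r c u) := by
  obtain ⟨f1, f2, f3⟩ := hf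
  rcases h with ⟨rfl, rfl, h⟩ | ⟨r₀, c₀, h1, h2, h3⟩
  · simp only [Bool.false_eq_true, if_false] at f3
    obtain ⟨rfl, f3⟩ := f3
    refine hg.setBox ?_ ?_ ?_ ?_ ?_
    · rintro j hj rfl
      have := f3 j hj (by omega); omega
    · omega
    · have := hg.row 0 c f1; omega
    · intro hc; have := hg.col 0 c hc; omega
    · omega
  · cases isCol
    · simp only [Bool.false_eq_true, if_false] at f3 h3
      obtain ⟨rfl, f3⟩ := f3
      obtain ⟨h3, rfl, h5, h6, h7⟩ := h3
      have hc : c ≤ c₀ := by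
        by_contra hc
        have := f3 c₀ h5 (by omega)
        omega
      refine hg.setBox ?_ ?_ ?_ ?_ ?_
      · rintro j hj rfl
        have := f3 j hj (by omega); omega
      · intro i hi hrc
        obtain rfl : i = r₀ := by omega
        have := hg.row_mono (r := i) (c := c) (c' := c₀) (by omega) hc
        omega
      · have := hg.row (r₀ + 1) c f1; omega
      · intro hc; have := hg.col (r₀ + 1) c hc; omega
      · omega
    · simp only [if_true] at f3 h3
      obtain ⟨rfl, f3⟩ := f3
      obtain ⟨h3, rfl, h5, h6⟩ := h3
      have hr : r ≤ r₀ := by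
        by_contra hr
        have := f3 r₀ (by omega)
        omega
      refine hg.setBox ?_ ?_ ?_ ?_ ?_
      · intro j hj hjc
        obtain rfl : j = c₀ := by omega
        have := hg.col_mono (r := r) (r' := r₀) (c := j) hr h1
        omega
      · rintro i rfl hi
        have := f3 i (by omega); omega
      · have := hg.row r (c₀ + 1) f1; omega
      · intro hc; have := hg.col r (c₀ + 1) hc; omega
      · omega

/-- A box whose value can be lowered to `u` is acted on by the insertion of `u` in its row or
column, according to the parity of `u`. -/
theorem Semi.pending_of_setBox {g : ℕ → ℕ → ℤ} (hg : Semi g) {r c : ℕ} {u : ℤ} (hrc : r ≤ c)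
    (hu : u < g r c) (hs : Semi (_root_.setBox g r c u))
    (hb : ∀ r, ∃ N, ∀ c, N ≤ c → u ≤ g r c) :
    Pending g (decide (u % 2 = 1)) (if u % 2 = 1 then c else r) u ∧
      FirstExceeds g (decide (u % 2 = 1)) (if u % 2 = 1 then c else r) u r c := by
  by_cases hp : u % 2 = 1
  · simp only [hp, decide_true, if_true]
    have hne : r ≠ c := by
      rintro rfl
      have := hs.diag r
      simp [_root_.setBox] at this
      omega
    obtain ⟨c, rfl⟩ : ∃ k, c = k + 1 := ⟨c - 1, by omega⟩
    have hleft := hs.row r c (by omega)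
    simp only [_root_.setBox, and_self, if_true] at hleft
    rw [if_neg (by omega)] at hleft
    constructor
    · have hex : ∃ i, i ≤ c ∧ r ≤ i ∧ g i c < u := ⟨r, by omega, le_rfl, by omega⟩
      have hmax : ∃ i, i ≤ c ∧ r ≤ i ∧ g i c < u ∧ (i < c → u ≤ g (i + 1) c) := by
        classical
        obtain ⟨i₀, hi₀, hi₁⟩ := hex
        have hP := Nat.findGreatest_spec (P := fun i => r ≤ i ∧ g i c < u) hi₀ hi₁
        refine ⟨_, Nat.findGreatest_le _, hP.1, hP.2, fun hlt => ?_⟩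
        by_contra hcon
        exact Nat.findGreatest_is_greatest (P := fun i => r ≤ i ∧ g i c < u)
          (Nat.lt_succ_self _) hlt
            ⟨hP.1.trans (Nat.le_succ _), by simpa using hcon⟩
      obtain ⟨i, h1, h2, h3, h4⟩ := hmax
      refine Or.inr ⟨i, c, h1, h3, ?_⟩
      simp only [if_true, true_and]
      refine ⟨by omega, ?_, h4⟩
      have := hg.col_mono (r := r) (r' := i) (c := c + 1) h2 (by omega)
      omega
    · refine ⟨hrc, hu, ?_⟩
      simp only [if_true, true_and]
      intro i hi
      obtain ⟨k, rfl⟩ : ∃ k, r = k + 1 := ⟨r - 1, by omega⟩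
      have h1 := hs.col k (c + 1) (by omega)
      simp only [_root_.setBox, and_self, if_true] at h1
      rw [if_neg (by omega)] at h1
      have := hg.col_mono (r := i) (r' := k) (c := c + 1) (by omega) (by omega)
      omega
  · simp only [hp, decide_false, if_false]
    constructor
    · rcases Nat.eq_zero_or_pos r with rfl | hr
      · exact Or.inl ⟨rfl, rfl, by omega⟩
      · obtain ⟨r, rfl⟩ : ∃ k, r = k + 1 := ⟨r - 1, by omega⟩
        have hbelow := hs.col r c (by omega)
        simp only [_root_.setBox, and_self, if_true] at hbelow
        rw [if_neg (by omega)] at hbelow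
        have hmax : ∃ j, c ≤ j ∧ g r j < u ∧ u ≤ g r (j + 1) := by
          classical
          have hex : ∃ j, u ≤ g r (c + j) := by
            obtain ⟨N, hN⟩ := hb r
            exact ⟨N, hN _ (by omega)⟩
          have h1 := Nat.find_spec hex
          have h0 : Nat.find hex ≠ 0 := by
            intro h0
            rw [h0, Nat.add_zero] at h1
            omega
          refine ⟨c + (Nat.find hex - 1), by omega, ?_, ?_⟩
          · have := Nat.find_min hex (m := Nat.find hex - 1) (by omega)
            omega
          · rw [show c + (Nat.find hex - 1) + 1 = c + Nat.find hex by omega]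
            exact h1
        obtain ⟨j, h1, h2, h3⟩ := hmax
        refine Or.inr ⟨r, j, by omega, h2, ?_⟩
        simp only [Bool.false_eq_true, if_false, true_and]
        refine ⟨by omega, by omega, h3, ?_⟩
        have := hg.row_mono (r := r + 1) (c := c) (c' := j) hrc h1
        omega
    · refine ⟨hrc, hu, ?_⟩
      simp only [Bool.false_eq_true, if_false, true_and]
      intro j hj hjc
      obtain ⟨k, rfl⟩ : ∃ k, c = k + 1 := ⟨c - 1, by omega⟩
      have h1 := hs.row r k (by omega)
      simp only [_root_.setBox, and_self, if_true] at h1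
      rw [if_neg (by omega)] at h1
      have := hg.row_mono (r := r) (c := j) (c' := k) hj (by omega)
      omega

/-- The number bumped from box `(r, c)`, where it is decreased by one on the main diagonal. -/
theorem Semi.bumpedFrom {g : ℕ → ℕ → ℤ} (hg : Semi g) {r c : ℕ} {u v : ℤ} (hrc : r ≤ c)
    (hu : u < g r c) (hs : Semi (_root_.setBox g r c u))
    (hv : v = if r = c then g r c - 1 else g r c) :
    BumpedFrom (_root_.setBox g r c u) (decide (v % 2 = 1)) (if v % 2 = 1 then c + 1 else r + 1)
      v r c := by
  have h1 := hg.row r c hrc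
  have h2 := hg.diag r
  have h3 := hs.diag r
  have h4 : _root_.setBox g r c u r c = u := by simp [_root_.setBox]
  have h5 : _root_.setBox g r c u r (c + 1) = g r (c + 1) := by simp [_root_.setBox]
  have h6 : _root_.setBox g r c u (r + 1) c = g (r + 1) c := by simp [_root_.setBox]
  unfold BumpedFrom
  rw [h4, h5, h6]
  by_cases hd : r = c
  · subst hd
    rw [h4] at h3
    simp only [if_true] at hv
    have hp : v % 2 = 1 := by omega
    simp only [hp, decide_true, if_true, true_and]
    refine ⟨by omega, by omega, by omega, by omega⟩
  · have h7 := hg.col r c (by omega)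
    simp only [hd, if_false] at hv
    by_cases hp : v % 2 = 1
    · simp only [hp, decide_true, if_true, true_and]
      refine ⟨hrc, by omega, by omega, by omega⟩
    · simp only [hp, decide_false, Bool.false_eq_true, if_false, true_and]
      refine ⟨hrc, by omega, by omega, by omega, by omega, by omega⟩

theorem BumpedFrom.semi_setBox {g : ℕ → ℕ → ℤ} (hg : Semi g) {isCol : Bool} {idx : ℕ} {v w : ℤ}
    {r c : ℕ} (h : BumpedFrom g isCol idx v r c) (hw : w = if r = c then v + 1 else v) :
    Semi (setBox g r c w) := by
  obtain ⟨h1, h2, h3⟩ := h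
  cases isCol
  · simp only [Bool.false_eq_true, if_false] at h3
    rw [if_neg (by omega)] at hw
    exact hg.setBox_of_le h1 (by omega) (by omega) (by omega) (by omega)
  · simp only [if_true] at h3
    split_ifs at hw with hd
    · exact hg.setBox_of_le h1 (by omega) (by omega) (by omega) (by omega)
    · exact hg.setBox_of_le h1 (by omega) (by omega) (by omega) (by omega)

/-! ## Stages of mixed insertion -/

/-- The values of a partial filling by letters, where an empty box in row `r` has value
`2 * (M + r)`. -/
def codes (M : ℤ) (G : ℕ → ℕ → Option Letter) (r c : ℕ) : ℤ :=
  match G r c with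
  | none => 2 * (M + r)
  | some x => x.code

theorem codes_of_none {M : ℤ} {G : ℕ → ℕ → Option Letter} {r c : ℕ} (h : G r c = none) :
    codes M G r c = 2 * (M + r) := by simp [codes, h]

theorem codes_of_some {M : ℤ} {G : ℕ → ℕ → Option Letter} {r c : ℕ} {x : Letter}
    (h : G r c = some x) : codes M G r c = x.code := by simp [codes, h]

theorem codes_updBox_some (M : ℤ) (G : ℕ → ℕ → Option Letter) (r c : ℕ) (x : Letter) :
    codes M (updBox G r c (some x)) = setBox (codes M G) r c x.code := by
  funext i j
  by_cases h : i = r ∧ j = c <;> simp [codes, updBox, setBox, h]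

theorem codes_updBox_none (M : ℤ) (G : ℕ → ℕ → Option Letter) (r c : ℕ) :
    codes M (updBox G r c none) = setBox (codes M G) r c (2 * (M + r)) := by
  funext i j
  by_cases h : i = r ∧ j = c
  · obtain ⟨rfl, rfl⟩ := h
    simp [codes, setBox]
  · simp [codes, updBox, setBox, h]

/-- `G` is supported on a finite set of boxes and its entries are positive with codes below
`2 * M - 1`. -/
structure IsBounded (M : ℤ) (G : ℕ → ℕ → Option Letter) : Prop where
  lower : ∀ r c, c < r → G r c = none
  finite : ∃ N, ∀ r c, N ≤ c → G r c = none
  range : ∀ r c x, G r c = some x → 0 < x.code ∧ x.code < 2 * M - 1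

/-- A semistandard filling of a shifted diagram without primed letters on the diagonal. -/
structure IsSemi (M : ℤ) (G : ℕ → ℕ → Option Letter) : Prop extends IsBounded M G where
  semi : Semi (codes M G)

theorem IsBounded.codes_lt_iff {M : ℤ} {G : ℕ → ℕ → Option Letter} (h : IsBounded M G) {r c : ℕ} :
    codes M G r c < 2 * M ↔ G r c ≠ none := by
  cases hG : G r c with
  | none => simp [codes_of_none hG]
  | some x =>
    have := (h.range r c x hG).2
    simp only [codes_of_some hG, ne_eq, reduceCtorEq, not_false_eq_true, iff_true]
    omega

theorem IsBounded.isShape {M : ℤ} {G : ℕ → ℕ → Option Letter} (h : IsBounded M G)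
    (hs : WeakSemi (codes M G)) : IsShape G := by
  refine ⟨h.lower, fun r c hrc => ?_, fun r c hrc => ?_, h.finite⟩
  · rw [← h.codes_lt_iff, ← h.codes_lt_iff]
    have := hs.row r c hrc
    omega
  · rw [← h.codes_lt_iff, ← h.codes_lt_iff]
    have := hs.col r c hrc
    omega

theorem IsBounded.updBox_some {M : ℤ} {G : ℕ → ℕ → Option Letter} (h : IsBounded M G) {r c : ℕ}
    (hrc : r ≤ c) {x : Letter} (h0 : 0 < x.code) (h1 : x.code < 2 * M - 1) :
    IsBounded M (updBox G r c (some x)) := by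
  obtain ⟨N, hN⟩ := h.finite
  refine ⟨fun i j hij => ?_, ⟨N + c + 1, fun i j hj => ?_⟩, fun i j y hy => ?_⟩
  · rw [updBox_of_ne _ _ (by omega)]
    exact h.lower i j hij
  · rw [updBox_of_ne _ _ (by omega)]
    exact hN i j (by omega)
  · by_cases hb : i = r ∧ j = c
    · obtain ⟨rfl, rfl⟩ := hb
      simp only [updBox_self, Option.some.injEq] at hy
      rw [← hy]
      exact ⟨h0, h1⟩
    · rw [updBox_of_ne _ _ hb] at hy
      exact h.range i j y hy

theorem IsBounded.updBox_none {M : ℤ} {G : ℕ → ℕ → Option Letter} (h : IsBounded M G) {r c : ℕ} :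
    IsBounded M (updBox G r c none) := by
  obtain ⟨N, hN⟩ := h.finite
  refine ⟨fun i j hij => ?_, ⟨N, fun i j hj => ?_⟩, fun i j y hy => ?_⟩
  · by_cases hb : i = r ∧ j = c
    · simp [updBox, hb]
    · rw [updBox_of_ne _ _ hb]; exact h.lower i j hij
  · by_cases hb : i = r ∧ j = c
    · simp [updBox, hb]
    · rw [updBox_of_ne _ _ hb]; exact hN i j hj
  · by_cases hb : i = r ∧ j = c
    · simp [updBox, hb] at hy
    · rw [updBox_of_ne _ _ hb] at hy; exact h.range i j y hy

/-- The letters of a filling by signed letters. -/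
def letters (F : ℕ → ℕ → Option (Bool × Letter)) (r c : ℕ) : Option Letter :=
  (F r c).map Prod.snd

theorem letters_of_some {F : ℕ → ℕ → Option (Bool × Letter)} {r c : ℕ} {e : Bool} {x : Letter}
    (h : F r c = some (e, x)) : letters F r c = some x := by simp [letters, h]

theorem letters_eq_none {F : ℕ → ℕ → Option (Bool × Letter)} {r c : ℕ} :
    letters F r c = none ↔ F r c = none := by simp [letters]

theorem letters_updBox (F : ℕ → ℕ → Option (Bool × Letter)) (r c : ℕ)
    (p : Option (Bool × Letter)) :
    letters (updBox F r c p) = updBox (letters F) r c (p.map Prod.snd) := by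
  funext i j
  by_cases h : i = r ∧ j = c <;> simp [letters, updBox, h]

theorem letters_updBox_some (F : ℕ → ℕ → Option (Bool × Letter)) (r c : ℕ) (e : Bool)
    (x : Letter) : letters (updBox F r c (some (e, x))) = updBox (letters F) r c (some x) :=
  letters_updBox F r c _

/-- A stage of mixed insertion: the signed letter `(sgn, letter)` is about to be inserted in row
or column `idx` of `filling`. -/
@[ext] structure Stage where
  filling : ℕ → ℕ → Option (Bool × Letter)
  isCol : Bool
  idx : ℕ
  sgn : Bool
  letter : Letter

/-- Whether signs are exchanged when bumping from box `(r, c)`. -/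
def swapsSigns (sympl : Bool) (r c : ℕ) : Bool := !sympl && decide (r = c)

/-- The letter inserted next after `v` is bumped from box `(r, c)`. -/
def bumpedLetter (r c : ℕ) (v : Letter) : Letter := if r = c then ⟨v.ceil, true⟩ else v

/-- The stage following `s` when `(e, v)` is bumped from box `(r, c)`. -/
def Stage.bump (sympl : Bool) (s : Stage) (r c : ℕ) (e : Bool) (v : Letter) : Stage where
  filling := updBox s.filling r c (some (if swapsSigns sympl r c then s.sgn else e, s.letter))
  isCol := (bumpedLetter r c v).primed
  idx := if (bumpedLetter r c v).primed then c + 1 else r + 1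
  sgn := if swapsSigns sympl r c then e else s.sgn
  letter := bumpedLetter r c v

/-- The stages occurring in mixed insertion. -/
structure Stage.IsValid (M : ℤ) (s : Stage) : Prop where
  isSemi : IsSemi M (letters s.filling)
  pos : 0 < s.letter.code
  lt : s.letter.code < 2 * M - 1
  pending : Pending (codes M (letters s.filling)) s.isCol s.idx s.letter.code

/-- The next box on which insertion acts. -/
def Stage.ActsOn (M : ℤ) (s : Stage) (r c : ℕ) : Prop :=
  FirstExceeds (codes M (letters s.filling)) s.isCol s.idx s.letter.code r c

/-- Insertion starting at the given stage results in a filling with a given new box. -/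
inductive Stage.Evals (sympl : Bool) (M : ℤ) :
    Stage → (ℕ → ℕ → Option (Bool × Letter)) → ℕ → ℕ → Prop
  | done (s : Stage) (r c : ℕ) : s.IsValid M → s.ActsOn M r c → s.filling r c = none →
      Stage.Evals sympl M s (updBox s.filling r c (some (s.sgn, s.letter))) r c
  | step (s : Stage) (r c : ℕ) (e : Bool) (v : Letter) (F : ℕ → ℕ → Option (Bool × Letter))
      (i j : ℕ) : s.IsValid M → s.ActsOn M r c → s.filling r c = some (e, v) →
      Stage.Evals sympl M (s.bump sympl r c e v) F i j → Stage.Evals sympl M s F i j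

section
variable {M : ℤ} {sympl : Bool}

theorem Stage.Evals.isValid {s : Stage} {F : ℕ → ℕ → Option (Bool × Letter)} {i j : ℕ}
    (h : s.Evals sympl M F i j) : s.IsValid M := by
  cases h <;> assumption

theorem Letter.even_or_odd (x : Letter) : x.primed = decide (x.code % 2 = 1) := by
  have := x.primed_iff_code
  cases h : x.primed <;> simp [h] at this ⊢ <;> omega

theorem bumpedLetter_code {r c : ℕ} {v : Letter} (h : r = c → v.code % 2 = 0) :
    (bumpedLetter r c v).code = if r = c then v.code - 1 else v.code := by
  unfold bumpedLetter
  split_ifs with hd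
  · rw [Letter.code_mk_true, Letter.ceil_eq_code]
    have := h hd
    omega
  · rfl

theorem Stage.IsValid.isSemi_updBox {s : Stage} (h : s.IsValid M) {r c : ℕ}
    (ha : s.ActsOn M r c) (e : Bool) :
    IsSemi M (letters (updBox s.filling r c (some (e, s.letter)))) := by
  rw [letters_updBox_some]
  refine ⟨h.isSemi.updBox_some ha.1 h.pos h.lt, ?_⟩
  rw [codes_updBox_some]
  exact h.pending.semi_setBox h.isSemi.semi ha

theorem Stage.IsValid.exists_actsOn {s : Stage} (h : s.IsValid M) : ∃ r c, s.ActsOn M r c := by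
  apply h.pending.exists_firstExceeds
  obtain ⟨N, hN⟩ := h.isSemi.finite
  refine ⟨N, ?_⟩
  have := codes_of_none (M := M) (hN 0 N le_rfl)
  have := h.lt
  omega

theorem Stage.IsValid.bumpedFrom {s : Stage} (h : s.IsValid M) {r c : ℕ} (ha : s.ActsOn M r c)
    {e : Bool} {v : Letter} (hv : s.filling r c = some (e, v)) :
    (bumpedLetter r c v).code = (if r = c then v.code - 1 else v.code) ∧
    BumpedFrom (codes M (letters (s.bump sympl r c e v).filling)) (s.bump sympl r c e v).isCol
      (s.bump sympl r c e v).idx (s.bump sympl r c e v).letter.code r c := by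
  have hc : codes M (letters s.filling) r c = v.code := codes_of_some (letters_of_some hv)
  have hb : (bumpedLetter r c v).code = if r = c then v.code - 1 else v.code := by
    apply bumpedLetter_code
    rintro rfl
    rw [← hc]
    exact h.isSemi.semi.diag r
  refine ⟨hb, ?_⟩
  have key := h.isSemi.semi.bumpedFrom ha.1 ha.2.1 (h.pending.semi_setBox h.isSemi.semi ha)
    (v := (bumpedLetter r c v).code) (by rw [hb, hc])
  simp only [Stage.bump, letters_updBox_some, codes_updBox_some]
  rw [Letter.even_or_odd]
  simpa using key

theorem Stage.IsValid.bump {s : Stage} (h : s.IsValid M) {r c : ℕ} (ha : s.ActsOn M r c)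
    {e : Bool} {v : Letter} (hv : s.filling r c = some (e, v)) :
    (s.bump sympl r c e v).IsValid M := by
  obtain ⟨hb, hp⟩ := h.bumpedFrom (sympl := sympl) ha hv
  obtain ⟨h0, h1⟩ := h.isSemi.range r c v (letters_of_some hv)
  have hlt : (bumpedLetter r c v).code ≤ v.code := by rw [hb]; split_ifs <;> omega
  have hpos : 0 < (bumpedLetter r c v).code := by
    have h2 := h.isSemi.semi.diag r
    have hc : codes M (letters s.filling) r c = v.code := codes_of_some (letters_of_some hv)
    rw [hb]
    split_ifs with hd
    · subst hd; omega
    · exact h0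
  exact ⟨h.isSemi_updBox ha _, hpos, by simp only [Stage.bump]; omega, Or.inr ⟨r, c, hp⟩⟩

/-- The boxes whose entries exceed the letter about to be inserted. -/
def Stage.larger (s : Stage) : Set (ℕ × ℕ) :=
  {b | ∃ p, s.filling b.1 b.2 = some p ∧ s.letter < p.2}

theorem finite_support {F : ℕ → ℕ → Option (Bool × Letter)} (h : IsBounded M (letters F)) :
    {b : ℕ × ℕ | ∃ p, F b.1 b.2 = some p}.Finite := by
  obtain ⟨N, hN⟩ := h.finite
  apply ((Set.finite_Iio N).prod (Set.finite_Iio N)).subset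
  rintro ⟨r, c⟩ ⟨p, hp⟩
  have hne : letters F r c ≠ none := by simp [letters, show F r c = some p from hp]
  have h1 : c < N := by
    by_contra hcon
    exact hne (hN r c (by omega))
  have h2 : r ≤ c := by
    by_contra hcon
    exact hne (h.lower r c (by omega))
  exact ⟨by simp; omega, h1⟩

theorem Stage.IsValid.ncard_larger_bump {s : Stage} (h : s.IsValid M) {r c : ℕ}
    (ha : s.ActsOn M r c) {e : Bool} {v : Letter} (hv : s.filling r c = some (e, v)) :
    (s.bump sympl r c e v).larger.ncard < s.larger.ncard := by
  have hfin : s.larger.Finite := by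
    apply (finite_support h.isSemi.toIsBounded).subset
    rintro b ⟨p, hp, -⟩
    exact ⟨p, hp⟩
  have hc : codes M (letters s.filling) r c = v.code := codes_of_some (letters_of_some hv)
  have hu : s.letter.code < v.code := hc ▸ ha.2.1
  have hle : s.letter.code ≤ (bumpedLetter r c v).code := by
    rw [(h.bumpedFrom (sympl := sympl) ha hv).1]
    split_ifs <;> omega
  apply Set.ncard_lt_ncard _ hfin
  rw [Set.ssubset_iff_of_subset]
  · refine ⟨(r, c), ⟨_, hv, Letter.lt_iff_code.2 hu⟩, ?_⟩
    rintro ⟨p, hp, hp2⟩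
    simp only [Stage.bump, updBox_self, Option.some.injEq] at hp hp2
    subst hp
    rw [Letter.lt_iff_code] at hp2
    simp only at hp2
    omega
  · rintro ⟨i, j⟩ ⟨p, hp, hp2⟩
    simp only [Stage.bump] at hp hp2
    rw [Letter.lt_iff_code] at hp2
    by_cases hb : i = r ∧ j = c
    · obtain ⟨rfl, rfl⟩ := hb
      simp only [updBox_self, Option.some.injEq] at hp
      subst hp
      simp only at hp2
      omega
    · rw [updBox_of_ne _ _ hb] at hp
      exact ⟨p, hp, Letter.lt_iff_code.2 (by omega)⟩

theorem Stage.IsValid.exists_evals {s : Stage} (h : s.IsValid M) :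
    ∃ F i j, s.Evals sympl M F i j := by
  induction hn : s.larger.ncard using Nat.strong_induction_on generalizing s with
  | _ n ih =>
    subst hn
    obtain ⟨r, c, ha⟩ := h.exists_actsOn
    cases hv : s.filling r c with
    | none => exact ⟨_, r, c, .done s r c h ha hv⟩
    | some p =>
      obtain ⟨e, v⟩ := p
      obtain ⟨F, i, j, hF⟩ := ih _ (h.ncard_larger_bump (sympl := sympl) ha hv)
        (h.bump ha hv) rfl
      exact ⟨F, i, j, .step s r c e v F i j h ha hv hF⟩

/-- The part of the sign of an entry in box `(r, c)` seen by the recording tableau. -/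
def recordedSign (sympl : Bool) (r c : ℕ) (e : Bool) : Bool :=
  if sympl then e else decide (r ≠ c) && e

theorem recordedSign_bump (r c : ℕ) (e e' : Bool) :
    recordedSign sympl r c (if swapsSigns sympl r c then e' else e) = recordedSign sympl r c e := by
  unfold recordedSign swapsSigns
  by_cases h : r = c <;> cases sympl <;> simp [h]

/-- The outcome of insertion. -/
theorem Stage.Evals.spec {s : Stage} {F : ℕ → ℕ → Option (Bool × Letter)} {i j : ℕ}
    (h : s.Evals sympl M F i j) :
    IsSemi M (letters F) ∧ s.filling i j = none ∧ F i j ≠ none ∧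
    ∀ r c, ¬(r = i ∧ c = j) → (F r c).map (fun p => recordedSign sympl r c p.1) =
      (s.filling r c).map (fun p => recordedSign sympl r c p.1) := by
  induction h with
  | done s r c h ha hn =>
    refine ⟨h.isSemi_updBox ha _, hn, by simp, fun i j hij => ?_⟩
    rw [updBox_of_ne _ _ hij]
  | step s r c e v F i j h ha hv _ ih =>
    obtain ⟨h1, h2, h3, h4⟩ := ih
    have hne : ¬(i = r ∧ j = c) := by
      rintro ⟨rfl, rfl⟩
      simp [Stage.bump] at h2
    refine ⟨h1, ?_, h3, fun r' c' hb => ?_⟩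
    · simp only [Stage.bump] at h2
      rwa [updBox_of_ne _ _ hne] at h2
    · rw [h4 r' c' hb]
      simp only [Stage.bump]
      by_cases hb' : r' = r ∧ c' = c
      · obtain ⟨rfl, rfl⟩ := hb'
        simp [hv, recordedSign_bump]
      · rw [updBox_of_ne _ _ hb']

end

section
variable {M : ℤ} {sympl : Bool}

theorem Stage.IsValid.isCol_eq {s : Stage} (h : s.IsValid M) : s.isCol = s.letter.primed := by
  rw [h.pending.parity, Letter.even_or_odd]

theorem Stage.IsValid.idx_eq {s : Stage} (h : s.IsValid M) {r c : ℕ} (ha : s.ActsOn M r c) :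
    s.idx = if s.letter.primed then c else r := by
  have h1 := ha.2.2
  rw [h.isCol_eq] at h1
  split_ifs at h1 ⊢
  · exact h1.1.symm
  · exact h1.1.symm

/-- The relation between consecutive stages of mixed insertion. -/
def Stage.Next (sympl : Bool) (M : ℤ) (s t : Stage) : Prop :=
  s.IsValid M ∧ ∃ r c e v, s.ActsOn M r c ∧ s.filling r c = some (e, v) ∧
    s.bump sympl r c e v = t

theorem Stage.IsValid.bump_filling_eq {s : Stage} {r c : ℕ} {e : Bool} {v : Letter}
    (hv : s.filling r c = some (e, v)) :
    s.filling = updBox (s.bump sympl r c e v).filling r c (some (e, v)) := by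
  simp only [Stage.bump]
  rw [updBox_updBox, updBox_eq_self hv]

theorem bumpedLetter_injective {r c : ℕ} {v w : Letter} (hv : r = c → v.primed = false)
    (hw : r = c → w.primed = false) (h : bumpedLetter r c v = bumpedLetter r c w) : v = w := by
  unfold bumpedLetter at h
  split_ifs at h with hd
  · obtain ⟨a, p⟩ := v
    obtain ⟨b, q⟩ := w
    simp_all
  · exact h

theorem Stage.IsValid.diag_unprimed {s : Stage} (h : s.IsValid M) {r c : ℕ} {e : Bool}
    {v : Letter} (hv : s.filling r c = some (e, v)) (hd : r = c) : v.primed = false := by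
  subst hd
  rw [Letter.unprimed_iff_code, ← codes_of_some (letters_of_some hv)]
  exact h.isSemi.semi.diag r

theorem Stage.Next.injective {s t u : Stage} (hs : s.Next sympl M u) (ht : t.Next sympl M u) :
    s = t := by
  obtain ⟨hs, r, c, e, v, ha, hv, rfl⟩ := hs
  obtain ⟨ht, r', c', e', v', ha', hv', heq⟩ := ht
  have hb := (hs.bumpedFrom (sympl := sympl) ha hv).2
  have hb' := (ht.bumpedFrom (sympl := sympl) ha' hv').2
  rw [heq] at hb'
  obtain ⟨rfl, rfl⟩ := hb.unique (hs.bump ha hv).isSemi.semi.toWeakSemi hb'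
  have h1 := congrArg Stage.filling heq
  have h2 := congrArg Stage.sgn heq
  have h3 := congrArg Stage.letter heq
  obtain rfl := bumpedLetter_injective (ht.diag_unprimed hv') (hs.diag_unprimed hv) h3
  have h4 := congrFun (congrFun h1 r) c
  simp only [Stage.bump, updBox_self, Option.some.injEq, Prod.mk.injEq] at h2 h4
  obtain ⟨h4, h5⟩ := h4
  have he : e = e' ∧ s.sgn = t.sgn := by
    split_ifs at h2 h4 <;> exact ⟨by simp_all, by simp_all⟩
  obtain ⟨rfl, h6⟩ := he
  have h7 : s.filling = t.filling := by
    rw [Stage.IsValid.bump_filling_eq (sympl := sympl) hv,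
      Stage.IsValid.bump_filling_eq (sympl := sympl) hv', heq]
  refine Stage.ext h7 ?_ ?_ h6 h5.symm
  · rw [hs.isCol_eq, ht.isCol_eq, h5]
  · rw [hs.idx_eq ha, ht.idx_eq ha', h5]

theorem Stage.Evals.exists_last {s : Stage} {F : ℕ → ℕ → Option (Bool × Letter)} {i j : ℕ}
    (h : s.Evals sympl M F i j) : ∃ t : Stage, t.IsValid M ∧ t.ActsOn M i j ∧
      t.filling i j = none ∧ F = updBox t.filling i j (some (t.sgn, t.letter)) ∧
      Relation.ReflTransGen (Stage.Next sympl M) s t := by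
  induction h with
  | done s r c h ha hn => exact ⟨s, h, ha, hn, rfl, .refl⟩
  | step s r c e v F i j h ha hv _ ih =>
    obtain ⟨t, h1, h2, h3, h4, h5⟩ := ih
    exact ⟨t, h1, h2, h3, h4, .head ⟨h, r, c, e, v, ha, hv, rfl⟩ h5⟩

theorem Stage.Evals.last_unique {s t : Stage} {i j : ℕ} (hs : s.IsValid M) (ht : t.IsValid M)
    (has : s.ActsOn M i j) (hat : t.ActsOn M i j) (hns : s.filling i j = none)
    (hnt : t.filling i j = none)
    (h : updBox s.filling i j (some (s.sgn, s.letter)) =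
      updBox t.filling i j (some (t.sgn, t.letter))) : s = t := by
  have h1 := congrFun (congrFun h i) j
  simp only [updBox_self, Option.some.injEq, Prod.mk.injEq] at h1
  obtain ⟨h1, h2⟩ := h1
  have h3 := congrArg (fun F => updBox F i j none) h
  simp only [updBox_updBox] at h3
  rw [updBox_eq_self hns, updBox_eq_self hnt] at h3
  refine Stage.ext h3 ?_ ?_ h1 h2
  · rw [hs.isCol_eq, ht.isCol_eq, h2]
  · rw [hs.idx_eq has, ht.idx_eq hat, h2]

theorem Stage.Evals.reachable {s t : Stage} {F : ℕ → ℕ → Option (Bool × Letter)} {i j : ℕ}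
    (hs : s.Evals sympl M F i j) (ht : t.Evals sympl M F i j) :
    Relation.ReflTransGen (Stage.Next sympl M) s t ∨
      Relation.ReflTransGen (Stage.Next sympl M) t s := by
  induction hs with
  | done s r c h ha hn =>
    obtain ⟨t', h1, h2, h3, h4, h5⟩ := ht.exists_last
    obtain rfl := Stage.Evals.last_unique h h1 ha h2 hn h3 h4
    exact Or.inr h5
  | step s r c e v F i j h ha hv _ ih =>
    have hn : s.Next sympl M (s.bump sympl r c e v) := ⟨h, r, c, e, v, ha, hv, rfl⟩
    rcases ih ht with h1 | h1
    · exact Or.inl (.head hn h1)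
    · rcases h1.cases_tail with h2 | ⟨s', h2, h3⟩
      · exact Or.inl (h2 ▸ .single hn)
      · obtain rfl := hn.injective h3
        exact Or.inr h2

theorem Stage.eq_of_reachable {s t : Stage}
    (h : Relation.ReflTransGen (Stage.Next sympl M) s t) (ht : t.idx = 0) : s = t := by
  rcases h.cases_tail with h2 | ⟨s', -, -, r, c, e, v, -, -, rfl⟩
  · exact h2.symm
  · simp only [Stage.bump] at ht
    split_ifs at ht

/-- Mixed insertion is injective. -/
theorem Stage.Evals.injective {s t : Stage} {F : ℕ → ℕ → Option (Bool × Letter)} {i j : ℕ}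
    (hs : s.Evals sympl M F i j) (ht : t.Evals sympl M F i j) (hs0 : s.idx = 0)
    (ht0 : t.idx = 0) : s = t := by
  rcases hs.reachable ht with h | h
  · exact Stage.eq_of_reachable h ht0
  · exact (Stage.eq_of_reachable h hs0).symm

/-- The boxes whose entries are less than the letter about to be inserted. -/
def Stage.smaller (s : Stage) : Set (ℕ × ℕ) :=
  {b | ∃ p, s.filling b.1 b.2 = some p ∧ p.2 < s.letter}

theorem Stage.ncard_smaller_lt {s : Stage} {r c : ℕ} {e : Bool} {v : Letter}
    (hs : IsBounded M (letters (s.bump sympl r c e v).filling))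
    (hu : s.letter < bumpedLetter r c v) (hv : s.filling r c = some (e, v))
    (hu' : s.letter < v) :
    s.smaller.ncard < (s.bump sympl r c e v).smaller.ncard := by
  have hfin : (s.bump sympl r c e v).smaller.Finite := by
    apply (finite_support hs).subset
    rintro b ⟨p, hp, -⟩
    exact ⟨p, hp⟩
  apply Set.ncard_lt_ncard _ hfin
  rw [Set.ssubset_iff_of_subset]
  · refine ⟨(r, c), ⟨_, by simp only [Stage.bump, updBox_self]; rfl, hu⟩, ?_⟩
    rintro ⟨p, hp, hp2⟩
    rw [hv] at hp
    cases hp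
    exact lt_asymm hp2 hu'
  · rintro ⟨i, j⟩ ⟨p, hp, hp2⟩
    have hne : ¬(i = r ∧ j = c) := by
      rintro ⟨rfl, rfl⟩
      rw [hv] at hp
      cases hp
      exact lt_asymm hp2 hu'
    refine ⟨p, ?_, lt_trans hp2 hu⟩
    simp only [Stage.bump]
    rw [updBox_of_ne _ _ hne]
    exact hp

theorem IsBounded.eventually_le {G : ℕ → ℕ → Option Letter} (h : IsBounded M G) {u : ℤ}
    (hu : u < 2 * M) (r : ℕ) : ∃ N, ∀ c, N ≤ c → u ≤ codes M G r c := by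
  obtain ⟨N, hN⟩ := h.finite
  refine ⟨N, fun c hc => ?_⟩
  rw [codes_of_none (hN r c hc)]
  omega

/-- An intermediate stage has a preceding one. -/
theorem Stage.IsValid.exists_previous {s : Stage} (h : s.IsValid M) {r c : ℕ}
    (hb : BumpedFrom (codes M (letters s.filling)) s.isCol s.idx s.letter.code r c) :
    ∃ t : Stage, t.Next sympl M s ∧ t.smaller.ncard < s.smaller.ncard := by
  obtain ⟨hrc, hlt, hb3⟩ := hb
  obtain ⟨⟨e, u⟩, hu⟩ : ∃ p, s.filling r c = some p := by
    rw [← Option.ne_none_iff_exists']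
    intro hn
    rw [codes_of_none (letters_eq_none.2 hn)] at hlt
    have := h.lt
    omega
  have hcu : codes M (letters s.filling) r c = u.code := codes_of_some (letters_of_some hu)
  obtain ⟨hu0, hu1⟩ := h.isSemi.range r c u (letters_of_some hu)
  have hdp : r = c → s.letter.primed = true := by
    rintro rfl
    rw [← h.isCol_eq]
    by_contra hcon
    simp [hcon] at hb3
  set v : Letter := if r = c then ⟨s.letter.ceil, false⟩ else s.letter with hvdef
  have hvb : bumpedLetter r c v = s.letter := by
    unfold bumpedLetter
    rw [hvdef]
    split_ifs with hd
    · have := hdp hd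
      cases hl : s.letter
      simp_all
    · rfl
  have hvc : v.code = if r = c then s.letter.code + 1 else s.letter.code := by
    rw [hvdef]
    split_ifs with hd
    · have := (Letter.primed_iff_code _).1 (hdp hd)
      rw [Letter.code_mk_false, Letter.ceil_eq_code]
      omega
    · rfl
  have hv1 : s.letter.code ≤ v.code := by rw [hvc]; split_ifs <;> omega
  have hv2 : v.code < 2 * M - 1 := by
    have := h.lt
    rw [hvc]
    split_ifs with hd
    · have := (Letter.primed_iff_code _).1 (hdp hd)
      omega
    · omega
  let ev : Bool := if swapsSigns sympl r c then s.sgn else e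
  let t : Stage := ⟨updBox s.filling r c (some (ev, v)), u.primed, if u.primed then c else r,
    if swapsSigns sympl r c then e else s.sgn, u⟩
  have htb : t.bump sympl r c ev v = s := by
    have hidx : s.idx = if s.letter.primed then c + 1 else r + 1 := by
      rw [← h.isCol_eq]
      split_ifs at hb3 ⊢
      · exact hb3.2.1
      · exact hb3.2.1
    apply Stage.ext
    · simp only [Stage.bump, t, ev, updBox_updBox]
      apply updBox_eq_self
      rw [hu]
      split_ifs <;> rfl
    · simp only [Stage.bump, hvb, h.isCol_eq]
    · simp only [Stage.bump, hvb, hidx]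
    · simp only [Stage.bump, t, ev]
      split_ifs <;> rfl
    · exact hvb
  have hcod : codes M (letters t.filling) = setBox (codes M (letters s.filling)) r c v.code := by
    simp only [t, letters_updBox_some, codes_updBox_some]
  have hsemi : IsSemi M (letters t.filling) := by
    refine ⟨?_, ?_⟩
    · simp only [t, letters_updBox_some]
      exact h.isSemi.updBox_some hrc (by have := h.pos; omega) hv2
    · rw [hcod]
      exact BumpedFrom.semi_setBox h.isSemi.semi ⟨hrc, hlt, hb3⟩ hvc
  have hback : setBox (codes M (letters t.filling)) r c u.code = codes M (letters s.filling) := by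
    rw [← codes_updBox_some, ← letters_updBox_some t.filling r c
      (if swapsSigns sympl r c then t.sgn else ev)]
    exact congrArg (fun s => codes M (letters s.filling)) htb
  have hpend := hsemi.semi.pending_of_setBox hrc (u := u.code)
    (by rw [hcod]; simp only [setBox, and_self, if_true]; omega)
    (by rw [hback]; exact h.isSemi.semi)
    (fun r => hsemi.eventually_le (by omega) r)
  have hpar : u.primed = decide (u.code % 2 = 1) := u.even_or_odd
  have hidx : (if u.primed then c else r) = if u.code % 2 = 1 then c else r := by
    rw [hpar]; simp
  rw [← hpar, ← hidx] at hpend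
  have htv : t.IsValid M := ⟨hsemi, hu0, hu1, hpend.1⟩
  refine ⟨t, ⟨htv, r, c, ev, v, hpend.2, by simp [t], htb⟩, ?_⟩
  have hl : t.letter < bumpedLetter r c v := by
    rw [hvb, Letter.lt_iff_code]
    simp only [t]
    omega
  have := Stage.ncard_smaller_lt (M := M) (s := t) (sympl := sympl) (r := r) (c := c) (e := ev)
    (v := v) (by rw [htb]; exact h.isSemi.toIsBounded) hl (by simp [t])
    (by rw [Letter.lt_iff_code]; simp only [t]; omega)
  rwa [htb] at this

theorem Stage.Evals.exists_initial {s : Stage} {F : ℕ → ℕ → Option (Bool × Letter)} {i j : ℕ}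
    (h : s.Evals sympl M F i j) :
    ∃ t : Stage, t.isCol = false ∧ t.idx = 0 ∧ t.Evals sympl M F i j := by
  induction hn : s.smaller.ncard using Nat.strong_induction_on generalizing s with
  | _ n ih =>
    subst hn
    rcases h.isValid.pending with ⟨h1, h2, -⟩ | ⟨r, c, hb⟩
    · exact ⟨s, h1, h2, h⟩
    · obtain ⟨t, ⟨ht, r', c', e, v, ha, hv, rfl⟩, hlt⟩ :=
        h.isValid.exists_previous (sympl := sympl) hb
      exact ih _ hlt (.step t r' c' e v F i j ht ha hv h) rfl

/-- Every corner of a filling arises as the new box of an insertion. -/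
theorem IsSemi.exists_evals {F : ℕ → ℕ → Option (Bool × Letter)} (h : IsSemi M (letters F))
    {i j : ℕ} (hij : F i j ≠ none) (hright : F i (j + 1) = none)
    (habove : i < j → F (i + 1) j = none) :
    ∃ s : Stage, s.isCol = false ∧ s.idx = 0 ∧ s.Evals sympl M F i j := by
  obtain ⟨⟨e, x⟩, hx⟩ := Option.ne_none_iff_exists'.1 hij
  have hxc : codes M (letters F) i j = x.code := codes_of_some (letters_of_some hx)
  obtain ⟨h0, h1⟩ := h.range i j x (letters_of_some hx)
  have hle : i ≤ j := by
    by_contra hcon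
    exact hij (letters_eq_none.1 (h.lower i j (by omega)))
  let s : Stage := ⟨updBox F i j none, x.primed, if x.primed then j else i, e, x⟩
  have hcod : codes M (letters s.filling) = setBox (codes M (letters F)) i j (2 * (M + i)) := by
    simp only [s, letters_updBox, Option.map_none, codes_updBox_none]
  have hback : setBox (codes M (letters s.filling)) i j x.code = codes M (letters F) := by
    rw [← codes_updBox_some, ← letters_updBox_some s.filling i j e]
    simp only [s]
    rw [updBox_updBox, updBox_eq_self hx]
  have hsemi : IsSemi M (letters s.filling) := by
    refine ⟨?_, ?_⟩
    · simp only [s, letters_updBox, Option.map_none]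
      exact h.updBox_none
    · rw [hcod]
      refine h.semi.setBox_of_le hle (by omega) ?_ (fun hlt => ?_) (by omega)
      · rw [codes_of_none (letters_eq_none.2 hright)]
        omega
      · rw [codes_of_none (letters_eq_none.2 (habove hlt))]
        push_cast
        omega
  have hpend := hsemi.semi.pending_of_setBox hle (u := x.code)
    (by rw [hcod]; simp only [setBox, and_self, if_true]; omega)
    (by rw [hback]; exact h.semi)
    (fun r => hsemi.eventually_le (by omega) r)
  have hpar : x.primed = decide (x.code % 2 = 1) := x.even_or_odd
  have hidx : (if x.primed then j else i) = if x.code % 2 = 1 then j else i := by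
    rw [hpar]; simp
  rw [← hpar, ← hidx] at hpend
  have hd := Stage.Evals.done (sympl := sympl) s i j ⟨hsemi, h0, h1, hpend.1⟩ hpend.2
    (by simp [s])
  have hF : updBox s.filling i j (some (s.sgn, s.letter)) = F := by
    simp only [s]
    rw [updBox_updBox, updBox_eq_self hx]
  rw [hF] at hd
  exact hd.exists_initial

end

/-! ## Mixed insertion on lists computes the evaluation of stages -/

section
variable {α : Type*} {M : ℤ} {sympl : Bool}

theorem List.findIdx?_eq_some_of_getElem? {l : List α} {p : α → Bool} {k : ℕ} {x : α}
    (hk : l[k]? = some x) (hx : p x = true)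
    (h : ∀ i < k, ∀ y, l[i]? = some y → p y = false) : l.findIdx? p = some k := by
  rw [List.findIdx?_eq_some_iff_getElem]
  obtain ⟨hlt, rfl⟩ := List.getElem?_eq_some_iff.1 hk
  refine ⟨hlt, hx, fun j hj => ?_⟩
  have := h j hj l[j] (List.getElem?_eq_getElem _)
  simp [this]

theorem List.findIdx?_eq_none_of_getElem? {l : List α} {p : α → Bool}
    (h : ∀ i : ℕ, ∀ y, l[i]? = some y → p y = false) : l.findIdx? p = none := by
  rw [List.findIdx?_eq_none_iff]
  intro x hx
  obtain ⟨i, hi⟩ := List.mem_iff_getElem?.1 hx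
  exact h i x hi

/-- The nonempty boxes of a column. -/
def columnList (f : ℕ → Option α) (n : ℕ) : List (ℕ × α) :=
  (List.range n).filterMap (fun i => (f i).map (fun x => (i, x)))

theorem columnList_add (f : ℕ → Option α) (r m : ℕ) : columnList f (r + m) = columnList f r ++
    ((List.range m).map (r + ·)).filterMap (fun i => (f i).map (fun x => (i, x))) := by
  unfold columnList
  rw [List.range_add, List.filterMap_append]

theorem mem_columnList {f : ℕ → Option α} {n : ℕ} {q : ℕ × α} :
    q ∈ columnList f n ↔ q.1 < n ∧ f q.1 = some q.2 := by
  unfold columnList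
  simp only [List.mem_filterMap, List.mem_range, Option.map_eq_some_iff]
  constructor
  · rintro ⟨a, h, b, h2, rfl⟩
    exact ⟨h, h2⟩
  · rintro ⟨h, h2⟩
    exact ⟨q.1, h, q.2, h2, rfl⟩

theorem columnList_find?_some {f : ℕ → Option α} {r n : ℕ} {x : α} (hr : r < n)
    (hx : f r = some x) {p : α → Bool} (hp : p x = true)
    (h : ∀ i < r, ∀ y, f i = some y → p y = false) :
    (columnList f n).find? (fun q => p q.2) = some (r, x) := by
  obtain ⟨m, rfl⟩ : ∃ m, n = r + (m + 1) := ⟨n - r - 1, by omega⟩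
  rw [columnList_add, List.find?_append, List.find?_eq_none.2, List.range_succ_eq_map]
  · simp [hx, hp]
  · rintro ⟨i, y⟩ hq
    obtain ⟨h1, h2⟩ := mem_columnList.1 hq
    simpa using h i h1 y h2

theorem columnList_find?_none {f : ℕ → Option α} {n : ℕ} {p : α → Bool}
    (h : ∀ i < n, ∀ y, f i = some y → p y = false) :
    (columnList f n).find? (fun q => p q.2) = none := by
  rw [List.find?_eq_none]
  rintro ⟨i, y⟩ hq
  obtain ⟨h1, h2⟩ := mem_columnList.1 hq
  simpa using h i h1 y h2

theorem length_columnList {f : ℕ → Option α} {r n : ℕ} (hr : r ≤ n)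
    (h1 : ∀ i < r, f i ≠ none) (h2 : ∀ i < n, r ≤ i → f i = none) :
    (columnList f n).length = r := by
  obtain ⟨m, rfl⟩ : ∃ m, n = r + m := ⟨n - r, by omega⟩
  rw [columnList_add, List.length_append]
  have h3 : ∀ k ≤ r, (columnList f k).length = k := by
    intro k hk
    induction k with
    | zero => rfl
    | succ k ih =>
      obtain ⟨x, hx⟩ := Option.ne_none_iff_exists'.1 (h1 k (by omega))
      rw [columnList_add, List.length_append, ih (by omega)]
      simp [hx]
  rw [h3 r le_rfl, List.filterMap_eq_nil_iff.2]
  · rfl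
  · intro a ha
    obtain ⟨i, hi, rfl⟩ := List.mem_map.1 ha
    rw [h2 _ (by have := List.mem_range.1 hi; omega) (by omega)]
    rfl

theorem IsShape.append_position {T : List (List α)} {r c : ℕ} {x : α}
    (h : IsShape (updBox (entryG? T) r c (some x))) (hn : entryG? T r c = none) :
    r ≤ c ∧ r ≤ T.length ∧ r + (T.getD r []).length = c := by
  have hrc : r ≤ c := by
    by_contra hcon
    simpa using h.lower r c (by omega)
  refine ⟨hrc, ?_, ?_⟩
  · rcases r with - | r
    · omega
    · have := h.below r c (by omega) (by simp)
      rw [updBox_of_ne _ _ (by omega)] at this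
      have := (lt_length_of_entryG?_ne_none this).2.1
      omega
  · have hlen : (T.getD r []).length ≤ c - r := by
      rwa [entryG?_getD T hrc, List.getElem?_eq_none_iff] at hn
    rcases Nat.lt_or_ge r c with hlt | hge
    · obtain ⟨c, rfl⟩ : ∃ k, c = k + 1 := ⟨c - 1, by omega⟩
      have := h.left r c (by omega) (by simp)
      rw [updBox_of_ne _ _ (by omega)] at this
      have := (lt_length_of_entryG?_ne_none this).2.2
      omega
    · omega

theorem Stage.IsValid.eq_some_of_code_le {s : Stage} (h : s.IsValid M) {i j : ℕ}
    (hle : codes M (letters s.filling) i j ≤ s.letter.code) :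
    ∃ q, s.filling i j = some q ∧ ¬ s.letter < q.2 := by
  obtain ⟨q, hq⟩ : ∃ q, s.filling i j = some q := by
    rw [← Option.ne_none_iff_exists']
    intro hn
    rw [codes_of_none (letters_eq_none.2 hn)] at hle
    have := h.lt
    omega
  refine ⟨q, hq, ?_⟩
  rw [codes_of_some (letters_of_some (e := q.1) (x := q.2) hq)] at hle
  rw [Letter.lt_iff_code]
  omega

theorem Stage.IsValid.column_spec {s : Stage} (h : s.IsValid M) {r c : ℕ} (ha : s.ActsOn M r c)
    (hcol : s.isCol = true) :
    s.idx = c ∧ r ≤ c ∧ ∀ i < r, ∃ q, s.filling i c = some q ∧ ¬ s.letter < q.2 := by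
  obtain ⟨h1, h2, h3⟩ := ha
  simp only [hcol, if_true] at h3
  exact ⟨h3.1.symm, h1, fun i hi => h.eq_some_of_code_le (h3.2 i hi)⟩

theorem Stage.IsValid.row_spec {s : Stage} (h : s.IsValid M) {r c : ℕ} (ha : s.ActsOn M r c)
    (hcol : s.isCol = false) :
    s.idx = r ∧ r ≤ c ∧ ∀ j, r ≤ j → j < c → ∃ q, s.filling r j = some q ∧ ¬ s.letter < q.2 := by
  obtain ⟨h1, h2, h3⟩ := ha
  simp only [hcol, Bool.false_eq_true, if_false] at h3
  exact ⟨h3.1.symm, h1, fun i hi hi' => h.eq_some_of_code_le (h3.2 i hi hi')⟩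

theorem isShape_letters {F : ℕ → ℕ → Option (Bool × Letter)} :
    IsShape (letters F) ↔ IsShape F := by
  constructor
  · rintro ⟨h1, h2, h3, h4⟩
    simp only [ne_eq, letters_eq_none] at h1 h2 h3 h4
    exact ⟨h1, h2, h3, h4⟩
  · rintro ⟨h1, h2, h3, h4⟩
    constructor <;> simpa only [ne_eq, letters_eq_none]

theorem Stage.IsValid.isShape {s : Stage} (h : s.IsValid M) : IsShape s.filling := by
  have := h.isSemi.isShape h.isSemi.semi.toWeakSemi
  simp only [isShape_letters] at this
  exact this

theorem hmIns_done {s : Stage} (h : s.IsValid M) {r c : ℕ} (ha : s.ActsOn M r c)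
    (hn : s.filling r c = none) {T : MTab} (hT : entryG? T = s.filling) (fuel : ℕ) :
    hmIns sympl (fuel + 1) T s.isCol s.idx (s.sgn, s.letter) =
      (setRowG T r (T.getD r [] ++ [(s.sgn, s.letter)]), (r, c)) := by
  have hshape : IsShape (updBox s.filling r c (some (s.sgn, s.letter))) := by
    have := h.isSemi_updBox ha s.sgn
    exact isShape_letters.1 (this.isShape this.semi.toWeakSemi)
  rw [← hT] at hshape
  obtain ⟨hrc, hr, hlen⟩ := hshape.append_position (by rw [hT]; exact hn)
  rw [hmIns]
  cases hcol : s.isCol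
  · obtain ⟨hidx, -, hrow⟩ := h.row_spec ha hcol
    simp only [Bool.false_eq_true, if_false]
    rw [hidx, List.findIdx?_eq_none_of_getElem?]
    · simp only [hlen]
    · intro k q hk
      have hk' : k < (T.getD r []).length := (List.getElem?_eq_some_iff.1 hk).1
      obtain ⟨q', hq', hlt⟩ := hrow (r + k) (by omega) (by omega)
      rw [← hT, entryG?_getD T (by omega), Nat.add_sub_cancel_left, hk] at hq'
      cases hq'
      simpa using hlt
  · obtain ⟨hidx, -, hc⟩ := h.column_spec ha hcol
    simp only [if_true]
    rw [hidx]
    have hnone : ∀ i, r ≤ i → entryG? T i c = none := by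
      intro i hi
      induction i, hi using Nat.le_induction with
      | base => rw [hT]; exact hn
      | succ i hi ih =>
        by_contra hcon
        rcases Nat.lt_or_ge i c with hic | hic
        · rw [hT] at hcon ih
          exact h.isShape.below i c hic hcon ih
        · exact hcon (entryG?_of_lt T (by omega))
    change (match (columnList (fun r => entryG? T r c) (c + 1)).find?
      (fun q => decide (s.letter < q.2.2)) with | none => _ | some p => _) = _
    rw [columnList_find?_none (p := fun q : Bool × Letter => decide (s.letter < q.2))]
    · change (setRowG T (columnList (fun r => entryG? T r c) (c + 1)).length
        (T.getD (columnList (fun r => entryG? T r c) (c + 1)).length [] ++ _),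
        ((columnList (fun r => entryG? T r c) (c + 1)).length, c)) = _
      have hl : (columnList (fun r => entryG? T r c) (c + 1)).length = r := by
        refine length_columnList (by omega) (fun i hi => ?_) (fun i _ hi => hnone i hi)
        obtain ⟨q, hq, -⟩ := hc i hi
        simp only [hT, hq]
        simp
      rw [hl]
    · intro i _ y hy
      rcases Nat.lt_or_ge i r with hi | hi
      · obtain ⟨q, hq, hlt⟩ := hc i hi
        simp only [hT] at hy
        rw [hq] at hy
        cases hy
        simpa using hlt
      · simp [hnone i hi] at hy

theorem hmIns_step {s : Stage} (h : s.IsValid M) {r c : ℕ} (ha : s.ActsOn M r c) {e : Bool}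
    {v : Letter} (hv : s.filling r c = some (e, v)) {T : MTab} (hT : entryG? T = s.filling)
    (hTn : NoEmptyRow T) (fuel : ℕ) : ∃ T' : MTab,
    hmIns sympl (fuel + 1) T s.isCol s.idx (s.sgn, s.letter) =
      hmIns sympl fuel T' (s.bump sympl r c e v).isCol (s.bump sympl r c e v).idx
        ((s.bump sympl r c e v).sgn, (s.bump sympl r c e v).letter) ∧
    NoEmptyRow T' ∧ entryG? T' = (s.bump sympl r c e v).filling := by
  have hne : entryG? T r c ≠ none := by rw [hT, hv]; simp
  obtain ⟨hrc, hr, hlen⟩ := lt_length_of_entryG?_ne_none hne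
  have hlt : s.letter < v := by
    rw [Letter.lt_iff_code, ← codes_of_some (M := M) (letters_of_some hv)]
    exact ha.2.1
  refine ⟨setEntryG T r c (if swapsSigns sympl r c then s.sgn else e, s.letter), ?_,
    hTn.setEntryG hne _, ?_⟩
  · rw [hmIns]
    cases hcol : s.isCol
    · obtain ⟨hidx, -, hrow⟩ := h.row_spec ha hcol
      have hk : (T.getD r [])[c - r]? = some (e, v) := by
        rw [← entryG?_getD T hrc, hT, hv]
      simp only [Bool.false_eq_true, if_false]
      rw [hidx, List.findIdx?_eq_some_of_getElem? hk (by simpa using hlt)]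
      · have hg : (T.getD r []).getD (c - r) default = (e, v) := by
          rw [List.getD_eq_getElem?_getD, hk]; rfl
        simp only [hg]
        rw [setEntryG_eq_setRowG T hr]
        by_cases hd : r = c
        · subst hd
          cases sympl <;> simp [Stage.bump, swapsSigns, bumpedLetter]
        · rw [if_neg (by omega)]
          simp [Stage.bump, swapsSigns, bumpedLetter, hd, show r + (c - r) = c by omega]
      · intro k hk q hq
        obtain ⟨q', hq', hlt⟩ := hrow (r + k) (by omega) (by omega)
        rw [← hT, entryG?_getD T (by omega), Nat.add_sub_cancel_left, hq] at hq'
        cases hq'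
        simpa using hlt
    · obtain ⟨hidx, -, hc⟩ := h.column_spec ha hcol
      simp only [if_true]
      rw [hidx]
      change (match (columnList (fun r => entryG? T r c) (c + 1)).find?
        (fun q => decide (s.letter < q.2.2)) with | none => _ | some p => _) = _
      rw [columnList_find?_some (r := r) (x := (e, v))
        (p := fun q : Bool × Letter => decide (s.letter < q.2)) (by omega)
        (by rw [hT, hv]) (by simpa using hlt)]
      · simp only
        by_cases hd : r = c
        · subst hd
          cases sympl <;> simp [Stage.bump, swapsSigns, bumpedLetter]
        · simp [Stage.bump, swapsSigns, bumpedLetter, hd]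
      · intro i hi y hy
        obtain ⟨q, hq, hlt⟩ := hc i hi
        rw [hT, hq] at hy
        cases hy
        simpa using hlt
  · rw [entryG?_setEntryG T hne, hT]
    rfl

theorem Stage.Evals.hmIns {s : Stage} {F : ℕ → ℕ → Option (Bool × Letter)} {i j : ℕ}
    (h : s.Evals sympl M F i j) {T : MTab} (hT : entryG? T = s.filling) (hTn : NoEmptyRow T)
    {fuel : ℕ} (hf : s.larger.ncard < fuel) :
    entryG? (_root_.hmIns sympl fuel T s.isCol s.idx (s.sgn, s.letter)).1 = F ∧
    NoEmptyRow (_root_.hmIns sympl fuel T s.isCol s.idx (s.sgn, s.letter)).1 ∧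
    (_root_.hmIns sympl fuel T s.isCol s.idx (s.sgn, s.letter)).2 = (i, j) := by
  induction h generalizing T fuel with
  | done s r c h ha hn =>
    obtain ⟨fuel, rfl⟩ : ∃ k, fuel = k + 1 := ⟨fuel - 1, by omega⟩
    rw [hmIns_done h ha hn hT]
    have hshape : IsShape (updBox (entryG? T) r c (some (s.sgn, s.letter))) := by
      have := h.isSemi_updBox ha s.sgn
      rw [hT]
      exact isShape_letters.1 (this.isShape this.semi.toWeakSemi)
    obtain ⟨-, hr, hlen⟩ := hshape.append_position (by rw [hT]; exact hn)
    exact ⟨by rw [entryG?_append_row T hr hlen, hT], hTn.setRowG _ (by simp), rfl⟩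
  | step s r c e v F i j h ha hv _ ih =>
    obtain ⟨fuel, rfl⟩ : ∃ k, fuel = k + 1 := ⟨fuel - 1, by omega⟩
    obtain ⟨T', h1, h2, h3⟩ := hmIns_step (sympl := sympl) h ha hv hT hTn fuel
    rw [h1]
    exact ih h3 h2 (by have := h.ncard_larger_bump (sympl := sympl) ha hv; omega)

end

/-! ## Insertion and recording tableaux of words -/

section
variable {M : ℤ} {sympl : Bool}

theorem IsShape.congr {α β : Type*} {F : ℕ → ℕ → Option α} {G : ℕ → ℕ → Option β}
    (hF : IsShape F) (h : ∀ r c, G r c = none ↔ F r c = none) : IsShape G := by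
  obtain ⟨h1, h2, h3, h4⟩ := hF
  refine ⟨fun r c hc => (h r c).2 (h1 r c hc), fun r c hc => ?_, fun r c hc => ?_, ?_⟩
  · rw [Ne, Ne, h, h]
    exact h2 r c hc
  · rw [Ne, Ne, h, h]
    exact h3 r c hc
  · obtain ⟨N, hN⟩ := h4
    exact ⟨N, fun r c hc => (h r c).2 (hN r c hc)⟩

/-- The first stage of the insertion of a primed letter. -/
def startStage (F : ℕ → ℕ → Option (Bool × Letter)) (x : Letter) : Stage :=
  ⟨F, false, 0, x.primed, ⟨x.ceil, false⟩⟩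

theorem startStage_isValid {F : ℕ → ℕ → Option (Bool × Letter)} (h : IsSemi M (letters F))
    {x : Letter} (h0 : 0 < x.ceil) (h1 : x.ceil < M) : (startStage F x).IsValid M := by
  have hc : (startStage F x).letter.code = 2 * x.ceil := by
    simp only [startStage, Letter.code_mk_false]
  refine ⟨h, by omega, by omega, Or.inl ⟨rfl, rfl, by omega⟩⟩

theorem Stage.IsValid.exists_startStage {s : Stage} (h : s.IsValid M) (hc : s.isCol = false)
    (hi : s.idx = 0) : ∃ x : Letter, 0 < x.ceil ∧ x.ceil < M ∧ startStage s.filling x = s := by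
  have hp := h.isCol_eq
  rw [hc] at hp
  have h0 := h.pos
  have h1 := h.lt
  have h2 := (Letter.unprimed_iff_code _).1 hp.symm
  have h3 := s.letter.ceil_eq_code
  refine ⟨⟨s.letter.ceil, s.sgn⟩, by simp only; omega, by simp only; omega, ?_⟩
  refine Stage.ext rfl hc.symm hi.symm rfl ?_
  change (⟨s.letter.ceil, false⟩ : Letter) = s.letter
  rw [hp]

theorem Stage.Evals.hmInsert {U : MTab} (hU : NoEmptyRow U) {x : Letter}
    {F : ℕ → ℕ → Option (Bool × Letter)} {i j : ℕ}
    (h : (startStage (entryG? U) x).Evals sympl M F i j) :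
    entryG? (hmInsert sympl U x).1 = F ∧ NoEmptyRow (_root_.hmInsert sympl U x).1 ∧
      (_root_.hmInsert sympl U x).2 = (i, j) := by
  refine h.hmIns (T := U) rfl hU ?_
  have h1 := countP_flatten_eq_ncard U (fun p => decide ((⟨x.ceil, false⟩ : Letter) < p.2))
  have h2 := List.countP_le_length (p := fun p : Bool × Letter =>
    decide ((⟨x.ceil, false⟩ : Letter) < p.2)) (l := U.flatten)
  simp only [decide_eq_true_eq] at h1
  change Set.ncard {b : ℕ × ℕ | ∃ p, entryG? U b.1 b.2 = some p ∧
    (⟨x.ceil, false⟩ : Letter) < p.2} < _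
  rw [← h1.1]
  omega

/-- One step of the construction of the insertion and recording tableaux. -/
def hmStep (sympl : Bool) (UQ : MTab × STab) (i : ℕ) (x : Letter) : MTab × STab :=
  ((hmInsert sympl UQ.1 x).1,
    setRowG UQ.2 (hmInsert sympl UQ.1 x).2.1 ((UQ.2.getD (hmInsert sympl UQ.1 x).2.1 []) ++
      [(⟨(i : ℤ), recordedSign sympl (hmInsert sympl UQ.1 x).2.1 (hmInsert sympl UQ.1 x).2.2
        (((entryG? (hmInsert sympl UQ.1 x).1 (hmInsert sympl UQ.1 x).2.1
          (hmInsert sympl UQ.1 x).2.2).map Prod.fst).getD false)⟩ : Letter)]))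

theorem hmAuxCS_append (U : MTab) (Q : STab) (l : List (ℕ × Letter)) (p : ℕ × Letter) :
    hmAuxCS sympl U Q (l ++ [p]) = hmStep sympl (hmAuxCS sympl U Q l) p.1 p.2 := by
  induction l generalizing U Q with
  | nil => rfl
  | cons q l ih => exact ih _ _

theorem wordCS_append (a : PWord) (x : Letter) :
    wordCS (a ++ [x]) = wordCS a ++ [(a.length + 1, x)] := by
  unfold wordCS
  rw [List.length_append, List.length_singleton, List.range_succ,
    List.zip_append (by simp), List.map_append]
  rfl

/-- The pair formed by a signed insertion tableau with `n` boxes and a compatible standard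
recording tableau. -/
structure IsRecording (sympl : Bool) (M : ℤ) (n : ℕ) (UQ : MTab × STab) : Prop where
  noEmptyRow_fst : NoEmptyRow UQ.1
  noEmptyRow_snd : NoEmptyRow UQ.2
  isSemi : IsSemi M (letters (entryG? UQ.1))
  signs : ∀ r c, (entryG? UQ.2 r c).map Letter.primed =
    (entryG? UQ.1 r c).map (fun p => recordedSign sympl r c p.1)
  increasing : IsIncreasing UQ.2
  range : ∀ r c x, entryG? UQ.2 r c = some x → 1 ≤ x.ceil ∧ x.ceil ≤ n
  existsUnique : ∀ i : ℤ, 1 ≤ i → i ≤ n →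
    ∃! b : ℕ × ℕ, ∃ x, entryG? UQ.2 b.1 b.2 = some x ∧ x.ceil = i

theorem IsRecording.eq_none_iff {n : ℕ} {UQ : MTab × STab} (h : IsRecording sympl M n UQ)
    (r c : ℕ) : entryG? UQ.2 r c = none ↔ entryG? UQ.1 r c = none := by
  have := h.signs r c
  cases h1 : entryG? UQ.2 r c <;> cases h2 : entryG? UQ.1 r c <;> simp_all

theorem IsSemi.isShape_of_letters {F : ℕ → ℕ → Option (Bool × Letter)}
    (h : IsSemi M (letters F)) : IsShape F :=
  isShape_letters.1 (h.isShape h.semi.toWeakSemi)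

theorem Stage.Evals.eq_none_iff {s : Stage} {F : ℕ → ℕ → Option (Bool × Letter)} {i j : ℕ}
    (h : s.Evals sympl M F i j) {r c : ℕ} (hb : ¬(r = i ∧ c = j)) :
    F r c = none ↔ s.filling r c = none := by
  have := h.spec.2.2.2 r c hb
  cases h1 : F r c <;> cases h2 : s.filling r c <;> simp_all

theorem IsRecording.hmStep_spec {n : ℕ} {UQ : MTab × STab} (h : IsRecording sympl M n UQ)
    {x : Letter} {F : ℕ → ℕ → Option (Bool × Letter)} {i j : ℕ}
    (hF : (startStage (entryG? UQ.1) x).Evals sympl M F i j) (m : ℕ) {e : Bool} {v : Letter}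
    (hv : F i j = some (e, v)) :
    NoEmptyRow (hmStep sympl UQ m x).1 ∧ NoEmptyRow (hmStep sympl UQ m x).2 ∧
    entryG? (hmStep sympl UQ m x).1 = F ∧
    entryG? (hmStep sympl UQ m x).2 =
      updBox (entryG? UQ.2) i j (some ⟨(m : ℤ), recordedSign sympl i j e⟩) := by
  obtain ⟨h1, h2, h3⟩ := hF.hmInsert h.noEmptyRow_fst
  obtain ⟨s1, s2, s3, s4⟩ := hF.spec
  have hshape : IsShape (updBox (entryG? UQ.2) i j
      (some (⟨(m : ℤ), recordedSign sympl i j e⟩ : Letter))) := by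
    refine s1.isShape_of_letters.congr fun r c => ?_
    by_cases hb : r = i ∧ c = j
    · obtain ⟨rfl, rfl⟩ := hb
      simp [hv]
    · rw [updBox_of_ne _ _ hb, hF.eq_none_iff hb, h.eq_none_iff]
      rfl
  obtain ⟨-, hr, hlen⟩ := hshape.append_position ((h.eq_none_iff i j).2 s2)
  unfold hmStep
  simp only [h3, h1, hv, Option.map_some, Option.getD_some]
  exact ⟨h2, h.noEmptyRow_snd.setRowG _ (by simp), trivial, entryG?_append_row _ hr hlen _⟩

theorem IsRecording.hmStep {n : ℕ} {UQ : MTab × STab} (h : IsRecording sympl M n UQ)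
    {x : Letter} (h0 : 0 < x.ceil) (h1 : x.ceil < M) :
    IsRecording sympl M (n + 1) (hmStep sympl UQ (n + 1) x) := by
  obtain ⟨F, i, j, hF⟩ := (startStage_isValid h.isSemi h0 h1).exists_evals (sympl := sympl)
  obtain ⟨s1, s2, s3, s4⟩ := hF.spec
  obtain ⟨⟨e, v⟩, hv⟩ := Option.ne_none_iff_exists'.1 s3
  obtain ⟨t1, t2, t3, t4⟩ := h.hmStep_spec hF (n + 1) hv
  have hQn : entryG? UQ.2 i j = none := (h.eq_none_iff i j).2 s2
  have hshape := s1.isShape_of_letters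
  have hout : ∀ r c, ¬(r = i ∧ c = j) → F r c = none → entryG? UQ.2 r c = none := by
    intro r c hb hn
    rw [h.eq_none_iff]
    exact (hF.eq_none_iff hb).1 hn
  have hright : entryG? UQ.2 i (j + 1) = none := by
    by_contra hcon
    have hs := h.isSemi.isShape_of_letters.congr h.eq_none_iff
    by_cases hle : i ≤ j
    · exact hs.left i j hle hcon hQn
    · exact s3 (hshape.lower i j (by omega))
  have habove : entryG? UQ.2 (i + 1) j = none := by
    by_contra hcon
    have hs := h.isSemi.isShape_of_letters.congr h.eq_none_iff
    by_cases hlt : i < j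
    · exact hs.below i j hlt hcon hQn
    · exact hcon (hs.lower _ _ (by omega))
  refine ⟨t1, t2, by rw [t3]; exact s1, fun r c => ?_, ⟨fun r c y z hy hz => ?_,
    fun r c y z hy hz => ?_⟩, fun r c y hy => ?_, fun k hk1 hk2 => ?_⟩
  · rw [t3, t4]
    by_cases hb : r = i ∧ c = j
    · obtain ⟨rfl, rfl⟩ := hb
      simp [hv]
    · rw [updBox_of_ne _ _ hb, s4 r c hb, h.signs]
      rfl
  · simp only [entry?, t4] at hy hz
    by_cases hb : r = i ∧ c = j
    · obtain ⟨rfl, rfl⟩ := hb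
      rw [updBox_of_ne _ _ (by omega), hright] at hz
      cases hz
    · rw [updBox_of_ne _ _ hb] at hy
      by_cases hb' : r = i ∧ c + 1 = j
      · obtain ⟨rfl, rfl⟩ := hb'
        simp only [updBox_self, Option.some.injEq] at hz
        subst hz
        have := h.range _ _ _ hy
        rw [Letter.lt_iff_code]
        unfold Letter.code
        split_ifs <;> push_cast <;> omega
      · rw [updBox_of_ne _ _ hb'] at hz
        exact h.increasing.1 r c y z hy hz
  · simp only [entry?, t4] at hy hz
    by_cases hb : r = i ∧ c = j
    · obtain ⟨rfl, rfl⟩ := hb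
      rw [updBox_of_ne _ _ (by omega), habove] at hz
      cases hz
    · rw [updBox_of_ne _ _ hb] at hy
      by_cases hb' : r + 1 = i ∧ c = j
      · obtain ⟨rfl, rfl⟩ := hb'
        simp only [updBox_self, Option.some.injEq] at hz
        subst hz
        have := h.range _ _ _ hy
        rw [Letter.lt_iff_code]
        unfold Letter.code
        split_ifs <;> push_cast <;> omega
      · rw [updBox_of_ne _ _ hb'] at hz
        exact h.increasing.2 r c y z hy hz
  · rw [t4] at hy
    by_cases hb : r = i ∧ c = j
    · obtain ⟨rfl, rfl⟩ := hb
      simp only [updBox_self, Option.some.injEq] at hy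
      subst hy
      simp
    · rw [updBox_of_ne _ _ hb] at hy
      have := h.range r c y hy
      push_cast
      omega
  · rw [t4]
    push_cast at hk2
    rcases (show k ≤ n ∨ k = n + 1 by omega) with hk | rfl
    · obtain ⟨b, ⟨y, hy, hyk⟩, hb⟩ := h.existsUnique k hk1 hk
      refine ⟨b, ⟨y, ?_, hyk⟩, ?_⟩
      · rw [updBox_of_ne]
        · exact hy
        · rintro ⟨h2, h3⟩
          rw [h2, h3, hQn] at hy
          cases hy
      · rintro b' ⟨z, hz, hzk⟩
        refine hb b' ⟨z, ?_, hzk⟩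
        rwa [updBox_of_ne] at hz
        rintro ⟨h2, h3⟩
        rw [h2, h3, updBox_self] at hz
        cases hz
        push_cast at hzk
        omega
    · refine ⟨(i, j), ⟨_, updBox_self _ _ _ _, by simp⟩, ?_⟩
      rintro ⟨r, c⟩ ⟨z, hz, hzk⟩
      by_contra hb
      simp only [Prod.mk.injEq] at hb
      simp only at hz
      rw [updBox_of_ne _ _ hb] at hz
      have := h.range _ _ _ hz
      omega

theorem IsRecording.hmStep_injective {n : ℕ} {UQ UQ' : MTab × STab}
    (h : IsRecording sympl M n UQ) (h' : IsRecording sympl M n UQ') {x y : Letter}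
    (hx0 : 0 < x.ceil) (hx1 : x.ceil < M) (hy0 : 0 < y.ceil) (hy1 : y.ceil < M)
    (heq : _root_.hmStep sympl UQ (n + 1) x = _root_.hmStep sympl UQ' (n + 1) y) :
    UQ = UQ' ∧ x = y := by
  obtain ⟨F, i, j, hF⟩ := (startStage_isValid h.isSemi hx0 hx1).exists_evals (sympl := sympl)
  obtain ⟨F', i', j', hF'⟩ :=
    (startStage_isValid h'.isSemi hy0 hy1).exists_evals (sympl := sympl)
  obtain ⟨⟨e, v⟩, hv⟩ := Option.ne_none_iff_exists'.1 hF.spec.2.2.1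
  obtain ⟨⟨e', v'⟩, hv'⟩ := Option.ne_none_iff_exists'.1 hF'.spec.2.2.1
  obtain ⟨-, -, t3, t4⟩ := h.hmStep_spec hF (n + 1) hv
  obtain ⟨-, -, t3', t4'⟩ := h'.hmStep_spec hF' (n + 1) hv'
  have hn : entryG? UQ.2 i j = none := (h.eq_none_iff i j).2 hF.spec.2.1
  have hn' : entryG? UQ'.2 i' j' = none := (h'.eq_none_iff i' j').2 hF'.spec.2.1
  rw [heq, t4'] at t4
  have hbox : i = i' ∧ j = j' := by
    by_contra hb
    have h1 := congrFun (congrFun t4 i) j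
    rw [updBox_self, updBox_of_ne _ _ hb] at h1
    have := h'.range _ _ _ h1
    simp at this
  obtain ⟨rfl, rfl⟩ := hbox
  have hQ := congrArg (fun G => updBox G i j none) t4
  simp only [updBox_updBox] at hQ
  rw [updBox_eq_self hn, updBox_eq_self hn'] at hQ
  rw [heq, t3'] at t3
  subst t3
  have hs := hF.injective hF' rfl rfl
  simp only [startStage, Stage.mk.injEq, true_and, Letter.mk.injEq, and_true] at hs
  obtain ⟨h1, h2, h3⟩ := hs
  refine ⟨Prod.ext ?_ ?_, ?_⟩
  · exact h.noEmptyRow_fst.ext h'.noEmptyRow_fst fun r c => by rw [h1]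
  · exact h.noEmptyRow_snd.ext h'.noEmptyRow_snd fun r c => by rw [hQ]
  · cases x
    cases y
    simp_all

theorem IsRecording.exists_hmStep {n : ℕ} {UQ : MTab × STab}
    (h : IsRecording sympl M (n + 1) UQ) : ∃ UQ' x, IsRecording sympl M n UQ' ∧ 0 < x.ceil ∧
      x.ceil < M ∧ _root_.hmStep sympl UQ' (n + 1) x = UQ := by
  obtain ⟨⟨i, j⟩, ⟨q, hq, hqn⟩, hu⟩ := h.existsUnique (n + 1) (by omega) (by push_cast; omega)
  simp only at hq hu
  have hmax : ∀ r c y, entryG? UQ.2 r c = some y → q < y → False := by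
    intro r c y hy hlt
    have h1 := (h.range r c y hy).2
    rw [Letter.lt_iff_code] at hlt
    have h2 := q.ceil_eq_code
    have h3 := y.ceil_eq_code
    push_cast at h1
    have := hu (r, c) ⟨y, hy, by omega⟩
    cases this
    rw [hq] at hy
    cases hy
    omega
  have hne : entryG? UQ.1 i j ≠ none := by
    rw [Ne, ← h.eq_none_iff, hq]
    simp
  obtain ⟨⟨e, v⟩, hv⟩ := Option.ne_none_iff_exists'.1 hne
  obtain ⟨s, hs1, hs2, hs⟩ := h.isSemi.exists_evals (sympl := sympl) hne
    (by
      rw [← h.eq_none_iff]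
      by_contra hcon
      obtain ⟨y, hy⟩ := Option.ne_none_iff_exists'.1 hcon
      exact hmax _ _ y hy (h.increasing.1 _ _ _ _ hq hy))
    (fun _ => by
      rw [← h.eq_none_iff]
      by_contra hcon
      obtain ⟨y, hy⟩ := Option.ne_none_iff_exists'.1 hcon
      exact hmax _ _ y hy (h.increasing.2 _ _ _ _ hq hy))
  obtain ⟨-, s2, -, s4⟩ := hs.spec
  obtain ⟨x, hx0, hx1, hxs⟩ := hs.isValid.exists_startStage hs1 hs2
  obtain ⟨U', hU', hUe⟩ := hs.isValid.isShape.exists_rows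
  have hUe' : entryG? U' = s.filling := funext fun r => funext fun c => hUe r c
  have hQs : IsShape (updBox (entryG? UQ.2) i j none) := by
    refine hs.isValid.isShape.congr fun r c => ?_
    by_cases hb : r = i ∧ c = j
    · obtain ⟨rfl, rfl⟩ := hb
      simp [s2]
    · rw [updBox_of_ne _ _ hb, h.eq_none_iff, hs.eq_none_iff hb]
  obtain ⟨Q', hQ', hQe⟩ := hQs.exists_rows
  have hold : ∀ r c y, entryG? Q' r c = some y → entryG? UQ.2 r c = some y ∧
      ¬(r = i ∧ c = j) := by
    intro r c y hy
    rw [hQe] at hy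
    by_cases hb : r = i ∧ c = j
    · obtain ⟨rfl, rfl⟩ := hb
      simp at hy
    · rw [updBox_of_ne _ _ hb] at hy
      exact ⟨hy, hb⟩
  have hrec : IsRecording sympl M n (U', Q') := by
    refine ⟨hU', hQ', by rw [hUe']; exact hs.isValid.isSemi, fun r c => ?_,
      ⟨fun r c y z hy hz => ?_, fun r c y z hy hz => ?_⟩, fun r c y hy => ?_,
      fun k hk1 hk2 => ?_⟩
    · simp only [hQe, hUe]
      by_cases hb : r = i ∧ c = j
      · obtain ⟨rfl, rfl⟩ := hb
        simp [s2]
      · rw [updBox_of_ne _ _ hb, h.signs, s4 r c hb]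
    · exact h.increasing.1 r c y z (hold _ _ _ hy).1 (hold _ _ _ hz).1
    · exact h.increasing.2 r c y z (hold _ _ _ hy).1 (hold _ _ _ hz).1
    · obtain ⟨h1, h2⟩ := hold r c y hy
      have h3 := h.range r c y h1
      refine ⟨h3.1, ?_⟩
      by_contra hcon
      have := hu (r, c) ⟨y, h1, by have := h3.2; push_cast at this; omega⟩
      simp only [Prod.mk.injEq] at this
      exact h2 this
    · obtain ⟨b, ⟨y, hy, hyk⟩, hb⟩ := h.existsUnique k hk1 (by push_cast; omega)
      refine ⟨b, ⟨y, ?_, hyk⟩, fun b' ⟨z, hz, hzk⟩ => hb b' ⟨z, (hold _ _ _ hz).1, hzk⟩⟩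
      simp only [hQe]
      rw [updBox_of_ne]
      · exact hy
      · rintro ⟨h1, h2⟩
        rw [h1, h2, hq] at hy
        cases hy
        omega
  have hss : startStage (entryG? (U', Q').1) x = s := by rw [← hxs, hUe']
  rw [← hss] at hs
  obtain ⟨t1, t2, t3, t4⟩ := hrec.hmStep_spec hs (n + 1) hv
  refine ⟨(U', Q'), x, hrec, hx0, hx1, Prod.ext ?_ ?_⟩
  · exact t1.ext h.noEmptyRow_fst fun r c => by rw [t3]
  · refine t2.ext h.noEmptyRow_snd fun r c => ?_
    rw [t4, show entryG? (U', Q').2 = updBox (entryG? UQ.2) i j none from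
      funext fun r => funext fun c => hQe r c, updBox_updBox, updBox_eq_self]
    have h1 := h.signs i j
    rw [hq, hv] at h1
    simp only [Option.map_some, Option.some.injEq] at h1
    rw [hq]
    cases q
    simp_all

theorem isRecording_zero_iff {UQ : MTab × STab} :
    IsRecording sympl M 0 UQ ↔ UQ = ([], []) := by
  constructor
  · intro h
    have hQ : ∀ r c, entryG? UQ.2 r c = none := by
      intro r c
      by_contra hcon
      obtain ⟨y, hy⟩ := Option.ne_none_iff_exists'.1 hcon
      have := h.range r c y hy
      push_cast at this
      omega
    have hnil : NoEmptyRow ([] : STab) ∧ NoEmptyRow ([] : MTab) := by simp [NoEmptyRow]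
    refine Prod.ext (h.noEmptyRow_fst.ext hnil.2 fun r c => ?_)
      (h.noEmptyRow_snd.ext hnil.1 fun r c => ?_)
    · rw [(h.eq_none_iff r c).1 (hQ r c), entryG?_nil]
    · rw [hQ, entryG?_nil]
  · rintro rfl
    have hs : letters (entryG? ([] : MTab)) = fun _ _ => none := by
      funext r c
      simp [letters]
    refine ⟨by simp [NoEmptyRow], by simp [NoEmptyRow], ?_, by simp, ?_, by simp, ?_⟩
    · rw [hs]
      refine ⟨⟨fun _ _ _ => rfl, ⟨0, fun _ _ _ => rfl⟩, by simp⟩, ⟨⟨?_, ?_⟩, ?_⟩⟩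
      · intro r c _
        simp only [codes]
        omega
      · intro r c _
        simp only [codes]
        push_cast
        omega
      · intro r
        simp only [codes]
        omega
    · constructor <;> simp [entry?]
    · intro i h1 h2
      push_cast at h2
      omega

theorem IsRecording.size_unique {n m : ℕ} {UQ : MTab × STab} (h : IsRecording sympl M n UQ)
    (h' : IsRecording sympl M m UQ) : n = m := by
  have key : ∀ {n m : ℕ}, IsRecording sympl M n UQ → IsRecording sympl M m UQ → n ≤ m := by
    intro n m h h'
    rcases Nat.eq_zero_or_pos n with rfl | hn
    · omega
    · obtain ⟨b, ⟨x, hx, hxn⟩, -⟩ := h.existsUnique n (by omega) le_rfl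
      have := h'.range _ _ _ hx
      omega
  exact le_antisymm (key h h') (key h' h)

theorem isRecording_word (a : PWord) (ha : ∀ x ∈ a, 0 < x.ceil ∧ x.ceil < M) :
    IsRecording sympl M a.length (hmAuxCS sympl [] [] (wordCS a)) := by
  induction a using List.reverseRecOn with
  | nil => exact isRecording_zero_iff.2 rfl
  | append_singleton a x ih =>
    rw [wordCS_append, hmAuxCS_append, List.length_append, List.length_singleton]
    have hx := ha x (by simp)
    exact (ih fun y hy => ha y (by simp [hy])).hmStep hx.1 hx.2

theorem hmAuxCS_wordCS_injective (a b : PWord) (ha : ∀ x ∈ a, 0 < x.ceil ∧ x.ceil < M)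
    (hb : ∀ x ∈ b, 0 < x.ceil ∧ x.ceil < M)
    (h : hmAuxCS sympl [] [] (wordCS a) = hmAuxCS sympl [] [] (wordCS b)) : a = b := by
  have hlen : a.length = b.length :=
    (isRecording_word (sympl := sympl) a ha).size_unique (h ▸ isRecording_word b hb)
  induction a using List.reverseRecOn generalizing b with
  | nil => exact (List.length_eq_zero_iff.1 hlen.symm).symm
  | append_singleton a x ih =>
    rcases List.eq_nil_or_concat b with rfl | ⟨b, y, rfl⟩
    · simp at hlen
    · have hl : a.length = b.length := by simpa using hlen
      have hx := ha x (by simp)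
      have hy := hb y (by simp)
      have ha' : ∀ x ∈ a, 0 < x.ceil ∧ x.ceil < M := fun z hz => ha z (by simp [hz])
      have hb' : ∀ x ∈ b, 0 < x.ceil ∧ x.ceil < M := fun z hz => hb z (by simp [hz])
      simp only [List.concat_eq_append] at h ⊢
      rw [wordCS_append, wordCS_append, hmAuxCS_append, hmAuxCS_append, ← hl] at h
      obtain ⟨h1, rfl⟩ := (isRecording_word a ha').hmStep_injective
        (hl ▸ isRecording_word b hb') hx.1 hx.2 hy.1 hy.2 h
      rw [ih b ha' hb' h1 hl]

theorem IsRecording.exists_word {n : ℕ} {UQ : MTab × STab} (h : IsRecording sympl M n UQ) :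
    ∃ a : PWord, a.length = n ∧ (∀ x ∈ a, 0 < x.ceil) ∧
      hmAuxCS sympl [] [] (wordCS a) = UQ := by
  induction n generalizing UQ with
  | zero => exact ⟨[], rfl, by simp, (isRecording_zero_iff.1 h).symm⟩
  | succ n ih =>
    obtain ⟨UQ', x, hrec, h0, -, rfl⟩ := h.exists_hmStep
    obtain ⟨a, h1, h2, rfl⟩ := ih hrec
    refine ⟨a ++ [x], by simp [h1], ?_, ?_⟩
    · intro y hy
      rcases List.mem_append.1 hy with hy | hy
      · exact h2 y hy
      · rw [List.mem_singleton.1 hy]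
        exact h0
    · rw [wordCS_append, hmAuxCS_append, h1]

end

/-! ## Extraction of the insertion tableau -/

section
variable {M : ℤ} {sympl : Bool}

/-- The letter recorded in box `(r, c)` of the insertion tableau. -/
def insertedLetter (sympl : Bool) (r c : ℕ) (p : Bool × Letter) : Letter :=
  if (sympl = false ∧ r = c) ∧ p.1 = true then ⟨p.2.ceil, true⟩ else p.2

/-- The insertion tableau extracted from a tableau of signed letters. -/
def extract (sympl : Bool) (U : MTab) : STab := if sympl then extractSp U else extractO U

theorem entryG?_extractO (U : MTab) (r c : ℕ) :
    entryG? (extractO U) r c = (entryG? U r c).map (insertedLetter false r c) := by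
  unfold entryG? extractO
  split_ifs with h
  · simp only [List.getElem?_map]
    rcases hU : U[r]? with _ | row
    · rfl
    · obtain ⟨k, rfl⟩ := Nat.exists_eq_add_of_le h
      rcases row with _ | ⟨⟨e, x⟩, row⟩
      · simp
      · rcases k with _ | k
        · simp [insertedLetter]
        · have hne : insertedLetter false r (r + (k + 1)) = Prod.snd := by
            funext p
            simp [insertedLetter]
          simp [hne]
  · rfl

theorem entryG?_extract (U : MTab) (r c : ℕ) :
    entryG? (extract sympl U) r c = (entryG? U r c).map (insertedLetter sympl r c) := by
  cases sympl
  · exact entryG?_extractO U r c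
  · simp only [extract, if_true, extractSp, entryG?_map]
    congr 1

theorem noEmptyRow_extract {U : MTab} (hU : NoEmptyRow U) : NoEmptyRow (extract sympl U) := by
  cases sympl
  · simp only [extract, Bool.false_eq_true, if_false, extractO, NoEmptyRow, List.mem_map]
    rintro _ ⟨row, hrow, rfl⟩
    have := hU row hrow
    rcases row with _ | ⟨⟨e, x⟩, row⟩ <;> simp_all
  · simp only [extract, if_true, extractSp, NoEmptyRow, List.mem_map]
    rintro _ ⟨row, hrow, rfl⟩
    simpa using hU row hrow

theorem entryG?_extract_eq_none {U : MTab} {r c : ℕ} :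
    entryG? (extract sympl U) r c = none ↔ entryG? U r c = none := by
  simp [entryG?_extract]

/-- Semistandardness in terms of codes. -/
theorem isSemistandard_iff {P : STab} (hP : IsShape (entryG? P))
    (hM : ∀ r c x, entryG? P r c = some x → x.ceil < M) :
    IsSemistandard P ↔ IsBounded M (entryG? P) ∧ WeakSemi (codes M (entryG? P)) := by
  constructor
  · rintro ⟨hpos, hrow, hcol, hrow', hcol'⟩
    have hrange : ∀ r c x, entryG? P r c = some x → 0 < x.code ∧ x.code < 2 * M - 1 := by
      intro r c x hx
      have h1 := hM r c x hx
      have h2 := hpos x ((mem_flatten_iff_entryG? P x).2 ⟨r, c, hx⟩)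
      have := x.ceil_eq_code
      omega
    refine ⟨⟨hP.lower, hP.bounded, hrange⟩, fun r c hrc => ?_, fun r c hrc => ?_⟩
    · cases hx : entryG? P r c with
      | none =>
        cases hy : entryG? P r (c + 1) with
        | none =>
          rw [codes_of_none hx, codes_of_none hy]
          omega
        | some y => exact absurd hx (hP.left r c hrc (by simp [hy]))
      | some x =>
        have hxr := hrange _ _ _ hx
        cases hy : entryG? P r (c + 1) with
        | none =>
          rw [codes_of_some hx, codes_of_none hy]
          omega
        | some y =>
          rw [codes_of_some hx, codes_of_some hy]
          have hle := Letter.le_iff_code.1 (hrow r c x y hx hy)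
          by_cases hxy : x = y
          · subst hxy
            have := (Letter.unprimed_iff_code x).1 (hrow' r c (c + 1) x (by omega) hx hy)
            omega
          · have := mt (@Letter.code_injective x y) hxy
            omega
    · cases hx : entryG? P r c with
      | none =>
        cases hy : entryG? P (r + 1) c with
        | none =>
          rw [codes_of_none hx, codes_of_none hy]
          push_cast
          omega
        | some y => exact absurd hx (hP.below r c hrc (by simp [hy]))
      | some x =>
        have hxr := hrange _ _ _ hx
        cases hy : entryG? P (r + 1) c with
        | none =>
          rw [codes_of_some hx, codes_of_none hy]
          push_cast
          omega
        | some y =>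
          rw [codes_of_some hx, codes_of_some hy]
          have hle := Letter.le_iff_code.1 (hcol r c x y hx hy)
          by_cases hxy : x = y
          · subst hxy
            have := (Letter.primed_iff_code x).1 (hcol' r (r + 1) c x (by omega) hx hy)
            omega
          · have := mt (@Letter.code_injective x y) hxy
            omega
  · rintro ⟨hb, hs⟩
    unfold IsSemistandard entry?
    have hle : ∀ {r c x}, entryG? P r c = some x → r ≤ c := by
      intro r c x hx
      by_contra hlt
      rw [entryG?_of_lt P (by omega)] at hx
      cases hx
    refine ⟨fun x hx => ?_, fun r c x y hx hy => ?_, fun r c x y hx hy => ?_,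
      fun r c c' x hc hx hy => ?_, fun r r' c x hr hx hy => ?_⟩
    · obtain ⟨r, c, hx⟩ := (mem_flatten_iff_entryG? P x).1 hx
      have := hb.range r c x hx
      have := x.ceil_eq_code
      omega
    · have := hs.row_mono (hle hx) (Nat.le_add_right c 1)
      rwa [codes_of_some hx, codes_of_some hy, ← Letter.le_iff_code] at this
    · have := hs.col_mono (Nat.le_add_right r 1) (hle hy)
      rwa [codes_of_some hx, codes_of_some hy, ← Letter.le_iff_code] at this
    · have h1 := hs.row r c (hle hx)
      have h2 := hs.row_mono (r := r) (c := c + 1) (c' := c')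
        (by have := hle hx; omega) hc
      rw [codes_of_some hx] at h1
      rw [codes_of_some hy] at h2
      rw [Letter.unprimed_iff_code]
      omega
    · have h1 := hs.col r c (by have := hle hy; omega)
      have h2 := hs.col_mono (r := r + 1) (r' := r') (c := c) hr (hle hy)
      rw [codes_of_some hx] at h1
      rw [codes_of_some hy] at h2
      rw [Letter.primed_iff_code]
      omega

theorem WeakSemi.congr_ceil {g g' : ℕ → ℕ → ℤ} (h : WeakSemi g)
    (hne : ∀ r c, r ≠ c → g' r c = g r c) (hceil : ∀ r, (g' r r + 1) / 2 = (g r r + 1) / 2) :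
    WeakSemi g' := by
  refine ⟨fun r c hrc => ?_, fun r c hrc => ?_⟩
  · have := h.row r c hrc
    rw [hne r (c + 1) (by omega)]
    rcases eq_or_ne r c with rfl | hrc'
    · rwa [hceil]
    · rwa [hne r c hrc']
  · have := h.col r c hrc
    rw [hne r c (by omega)]
    rcases eq_or_ne (r + 1) c with rfl | hrc'
    · have := hceil (r + 1)
      omega
    · rwa [hne _ c hrc']

theorem insertedLetter_ceil (r c : ℕ) (p : Bool × Letter) :
    (insertedLetter sympl r c p).ceil = p.2.ceil := by
  unfold insertedLetter
  split_ifs <;> rfl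

theorem codes_extract {U : MTab} {r c : ℕ} (h : r ≠ c) :
    codes M (entryG? (extract sympl U)) r c = codes M (letters (entryG? U)) r c := by
  simp only [codes, entryG?_extract, letters]
  cases entryG? U r c <;> simp [insertedLetter, h]

theorem codes_extract_diag (U : MTab) (r : ℕ) :
    (codes M (entryG? (extract sympl U)) r r + 1) / 2 =
      (codes M (letters (entryG? U)) r r + 1) / 2 := by
  simp only [codes, entryG?_extract, letters]
  cases entryG? U r r with
  | none => rfl
  | some p =>
    simp only [Option.map_some, ← Letter.ceil_eq_code]
    exact insertedLetter_ceil r r p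

theorem isBounded_extract {U : MTab} :
    IsBounded M (entryG? (extract sympl U)) ↔ IsBounded M (letters (entryG? U)) := by
  have hn : ∀ r c, entryG? (extract sympl U) r c = none ↔ letters (entryG? U) r c = none :=
    fun r c => by rw [entryG?_extract_eq_none, letters_eq_none]
  constructor
  · rintro ⟨h1, ⟨N, h2⟩, h3⟩
    refine ⟨fun r c h => (hn r c).1 (h1 r c h), ⟨N, fun r c h => (hn r c).1 (h2 r c h)⟩, ?_⟩
    intro r c x hx
    obtain ⟨p, hp, rfl⟩ := Option.map_eq_some_iff.1 hx
    have := h3 r c (insertedLetter sympl r c p) (by rw [entryG?_extract, hp]; rfl)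
    have h4 := insertedLetter_ceil (sympl := sympl) r c p
    rw [Letter.ceil_eq_code, Letter.ceil_eq_code] at h4
    omega
  · rintro ⟨h1, ⟨N, h2⟩, h3⟩
    refine ⟨fun r c h => (hn r c).2 (h1 r c h), ⟨N, fun r c h => (hn r c).2 (h2 r c h)⟩, ?_⟩
    intro r c x hx
    rw [entryG?_extract] at hx
    obtain ⟨p, hp, rfl⟩ := Option.map_eq_some_iff.1 hx
    have := h3 r c p.2 (by simp [letters, hp])
    have h4 := insertedLetter_ceil (sympl := sympl) r c p
    rw [Letter.ceil_eq_code, Letter.ceil_eq_code] at h4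
    omega

theorem weakSemi_extract {U : MTab} :
    WeakSemi (codes M (entryG? (extract sympl U))) ↔ WeakSemi (codes M (letters (entryG? U))) :=
  ⟨fun h => h.congr_ceil (fun _ _ hrc => (codes_extract hrc).symm)
      fun r => (codes_extract_diag U r).symm,
    fun h => h.congr_ceil (fun _ _ hrc => codes_extract hrc) fun r => codes_extract_diag U r⟩

/-! ## Standard tableaux -/

theorem countP_ceil_mem (l : List Letter) (s : Finset ℤ) :
    l.countP (fun x => decide (x.ceil ∈ s)) =
      ∑ i ∈ s, l.countP (fun x => decide (x.ceil = i)) := by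
  induction l with
  | nil => simp
  | cons x l ih =>
    simp only [List.countP_cons, ih, Finset.sum_add_distrib, decide_eq_true_eq]
    rw [Finset.sum_ite_eq]

theorem countP_ceil_eq_one_iff (Q : STab) (i : ℤ) :
    Q.flatten.countP (fun x => decide (x.ceil = i)) = 1 ↔
      ∃! b : ℕ × ℕ, ∃ x, entryG? Q b.1 b.2 = some x ∧ x.ceil = i := by
  rw [(countP_flatten_eq_ncard Q _).1, Set.ncard_eq_one]
  simp only [decide_eq_true_eq]
  constructor
  · rintro ⟨b, hb⟩
    have hmem : ∀ b', (∃ x, entryG? Q b'.1 b'.2 = some x ∧ x.ceil = i) ↔ b' = b :=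
      fun b' => Set.ext_iff.1 hb b'
    exact ⟨b, (hmem b).2 rfl, fun b' h => (hmem b').1 h⟩
  · rintro ⟨b, hb, hu⟩
    exact ⟨b, Set.ext fun b' => ⟨fun h => hu b' h, fun h => h ▸ hb⟩⟩

theorem IsStandard.range {Q : STab} (h : IsStandard Q) {r c : ℕ} {x : Letter}
    (hx : entryG? Q r c = some x) : 1 ≤ x.ceil ∧ x.ceil ≤ (Q.flatten.length : ℤ) := by
  have h1 := countP_ceil_mem Q.flatten (Finset.Icc 1 (Q.flatten.length : ℤ))
  rw [Finset.sum_congr rfl fun i hi =>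
    h.2 i (Finset.mem_Icc.1 hi).1 (Finset.mem_Icc.1 hi).2] at h1
  simp only [Finset.sum_const, Int.card_Icc, add_sub_cancel_right, Int.toNat_natCast,
    smul_eq_mul, mul_one] at h1
  have h2 := List.countP_eq_length.1 h1 x ((mem_flatten_iff_entryG? Q x).2 ⟨r, c, hx⟩)
  simpa using h2

theorem length_flatten_eq {Q : STab} {n : ℕ}
    (hr : ∀ r c x, entryG? Q r c = some x → 1 ≤ x.ceil ∧ x.ceil ≤ n)
    (hu : ∀ i : ℤ, 1 ≤ i → i ≤ n → ∃! b : ℕ × ℕ, ∃ x, entryG? Q b.1 b.2 = some x ∧ x.ceil = i) :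
    Q.flatten.length = n := by
  have h1 := countP_ceil_mem Q.flatten (Finset.Icc 1 (n : ℤ))
  rw [Finset.sum_congr rfl fun i hi => (countP_ceil_eq_one_iff Q i).2 <|
    hu i (Finset.mem_Icc.1 hi).1 (Finset.mem_Icc.1 hi).2] at h1
  simp only [Finset.sum_const, Int.card_Icc, add_sub_cancel_right, Int.toNat_natCast,
    smul_eq_mul, mul_one] at h1
  rw [← h1, eq_comm, List.countP_eq_length]
  intro x hx
  obtain ⟨r, c, hx⟩ := (mem_flatten_iff_entryG? Q x).1 hx
  simpa using hr r c x hx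

/-! ## The correspondence -/

/-- Pairs of a semistandard and a standard shifted tableau of the same shape, one of which has no
primed entries on the main diagonal. -/
def tableauPairs (sympl : Bool) : Set (STab × STab) :=
  {PQ | shapeOf PQ.1 = shapeOf PQ.2 ∧ IsShifted PQ.1 ∧ IsShifted PQ.2 ∧
    IsSemistandard PQ.1 ∧ IsStandard PQ.2 ∧ NoDiagPrimes (if sympl then PQ.1 else PQ.2)}

theorem IsRecording.mem_tableauPairs {n : ℕ} {UQ : MTab × STab} (h : IsRecording sympl M n UQ) :
    (extract sympl UQ.1, UQ.2) ∈ tableauPairs sympl := by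
  have hU := h.isSemi.isShape_of_letters
  have hP : IsShape (entryG? (extract sympl UQ.1)) :=
    hU.congr fun r c => entryG?_extract_eq_none
  have hQ : IsShape (entryG? UQ.2) := hU.congr h.eq_none_iff
  have hPn := noEmptyRow_extract (sympl := sympl) h.noEmptyRow_fst
  have hb := isBounded_extract (sympl := sympl).2 h.isSemi.toIsBounded
  refine ⟨(shapeOf_eq_iff hPn h.noEmptyRow_snd).2 fun r c => not_congr ?_,
    (isShifted_iff_isShape _).2 ⟨hPn, hP⟩, (isShifted_iff_isShape _).2 ⟨h.noEmptyRow_snd, hQ⟩,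
    (isSemistandard_iff hP fun r c x hx => ?_).2
      ⟨hb, weakSemi_extract.2 h.isSemi.semi.toWeakSemi⟩, ⟨h.increasing, ?_⟩, ?_⟩
  · rw [entryG?_extract_eq_none, h.eq_none_iff]
  · have := hb.range r c x hx
    have := x.ceil_eq_code
    omega
  · rw [length_flatten_eq h.range h.existsUnique]
    exact fun i h0 h1 => (countP_ceil_eq_one_iff _ i).2 (h.existsUnique i h0 h1)
  · intro r x hx
    cases sympl
    · have := h.signs r r
      have hx' : entryG? UQ.2 r r = some x := hx
      rw [hx'] at this
      cases hp : entryG? UQ.1 r r <;> simp_all [recordedSign]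
    · have hx' : entryG? (extract true UQ.1) r r = some x := hx
      rw [entryG?_extract] at hx'
      obtain ⟨p, hp, rfl⟩ := Option.map_eq_some_iff.1 hx'
      have := h.isSemi.semi.diag r
      rw [codes_of_some (letters_of_some (e := p.1) (x := p.2) hp)] at this
      simpa [insertedLetter] using (Letter.unprimed_iff_code _).2 this

/-- The signed letter with given insertion and recording entries. -/
def signedLetter (sympl : Bool) (r c : ℕ) (x y : Letter) : Bool × Letter :=
  if sympl = false ∧ r = c then (x.primed, ⟨x.ceil, false⟩) else (y.primed, x)

theorem signedLetter_insertedLetter {r c : ℕ} {p : Bool × Letter} {y : Letter}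
    (hp : r = c → p.2.primed = false) (hy : y.primed = recordedSign sympl r c p.1) :
    signedLetter sympl r c (insertedLetter sympl r c p) y = p := by
  obtain ⟨e, a, b⟩ := p
  cases sympl <;> by_cases hrc : r = c <;> cases e <;>
    simp_all [signedLetter, insertedLetter, recordedSign]

theorem insertedLetter_signedLetter (r c : ℕ) (x y : Letter) :
    insertedLetter sympl r c (signedLetter sympl r c x y) = x := by
  obtain ⟨a, b⟩ := x
  cases sympl <;> by_cases hrc : r = c <;> cases b <;>
    simp_all [signedLetter, insertedLetter]

theorem recordedSign_signedLetter {r c : ℕ} (x : Letter) {y : Letter}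
    (hy : sympl = false → r = c → y.primed = false) :
    recordedSign sympl r c (signedLetter sympl r c x y).1 = y.primed := by
  cases sympl <;> by_cases hrc : r = c <;> simp_all [signedLetter, recordedSign]

theorem IsRecording.entryG?_fst {n : ℕ} {UQ : MTab × STab} (h : IsRecording sympl M n UQ)
    (r c : ℕ) : entryG? UQ.1 r c = (entryG? (extract sympl UQ.1) r c).bind
      fun x => (entryG? UQ.2 r c).map (signedLetter sympl r c x) := by
  rw [entryG?_extract]
  cases hp : entryG? UQ.1 r c with
  | none => rfl
  | some p =>
    obtain ⟨y, hy⟩ := Option.ne_none_iff_exists'.1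
      (mt (h.eq_none_iff r c).1 (by simp [hp] : entryG? UQ.1 r c ≠ none))
    have hs := h.signs r c
    rw [hy, hp] at hs
    simp only [hy, Option.map_some, Option.bind_some, Option.some.injEq] at hs ⊢
    refine (signedLetter_insertedLetter (fun hrc => ?_) hs).symm
    subst hrc
    have := h.isSemi.semi.diag r
    rw [codes_of_some (letters_of_some (e := p.1) (x := p.2) hp)] at this
    exact (Letter.unprimed_iff_code _).2 this

theorem IsRecording.eq_of_extract {n m : ℕ} {UQ UQ' : MTab × STab}
    (h : IsRecording sympl M n UQ) (h' : IsRecording sympl M m UQ')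
    (hP : extract sympl UQ.1 = extract sympl UQ'.1) (hQ : UQ.2 = UQ'.2) : UQ = UQ' := by
  refine Prod.ext (h.noEmptyRow_fst.ext h'.noEmptyRow_fst fun r c => ?_) hQ
  rw [h.entryG?_fst, h'.entryG?_fst, hP, hQ]

theorem List.exists_ceil_lt (l : List Letter) : ∃ M : ℤ, ∀ x ∈ l, x.ceil < M := by
  induction l with
  | nil => exact ⟨0, by simp⟩
  | cons x l ih =>
    obtain ⟨M, hM⟩ := ih
    refine ⟨max M (x.ceil + 1), fun y hy => ?_⟩
    rcases List.mem_cons.1 hy with rfl | hy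
    · exact lt_max_of_lt_right (by omega)
    · exact lt_max_of_lt_left (hM y hy)

theorem exists_isRecording {PQ : STab × STab} (h : PQ ∈ tableauPairs sympl) :
    ∃ (M : ℤ) (n : ℕ) (U : MTab), extract sympl U = PQ.1 ∧ IsRecording sympl M n (U, PQ.2) := by
  obtain ⟨P, Q⟩ := PQ
  obtain ⟨hsh, hP, hQ, hss, hst, hdiag⟩ := h
  simp only at hsh hP hQ hss hst hdiag ⊢
  rw [isShifted_iff_isShape] at hP hQ
  have hPQ := (shapeOf_eq_iff hP.1 hQ.1).1 hsh
  obtain ⟨M, hM⟩ := P.flatten.exists_ceil_lt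
  obtain ⟨hb, hw⟩ := (isSemistandard_iff hP.2 fun r c x hx =>
    hM x ((mem_flatten_iff_entryG? P x).2 ⟨r, c, hx⟩)).1 hss
  have hshape : IsShape fun r c => (entryG? P r c).bind
      fun x => (entryG? Q r c).map (signedLetter sympl r c x) := by
    refine hP.2.congr fun r c => ?_
    have := hPQ r c
    cases h1 : entryG? P r c <;> cases h2 : entryG? Q r c <;> simp_all
  obtain ⟨U, hUn, hU⟩ := hshape.exists_rows
  have hext : extract sympl U = P := by
    refine (noEmptyRow_extract hUn).ext hP.1 fun r c => ?_
    rw [entryG?_extract, hU]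
    have := hPQ r c
    cases h1 : entryG? P r c <;> cases h2 : entryG? Q r c <;>
      simp_all [insertedLetter_signedLetter]
  subst hext
  refine ⟨M, Q.flatten.length, U, rfl, hUn, hQ.1,
    ⟨isBounded_extract.1 hb, weakSemi_extract.1 hw, fun r => ?_⟩, fun r c => ?_, hst.1,
    fun r c x hx => hst.range hx,
    fun i h0 h1 => (countP_ceil_eq_one_iff Q i).1 (hst.2 i h0 h1)⟩
  · cases hp : entryG? U r r with
    | none =>
      rw [codes_of_none (letters_eq_none.2 hp)]
      omega
    | some p =>
      rw [codes_of_some (letters_of_some (e := p.1) (x := p.2) hp), ← Letter.unprimed_iff_code]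
      have h1 := hU r r
      rw [hp] at h1
      obtain ⟨x, hx, h1⟩ := Option.bind_eq_some_iff.1 h1.symm
      obtain ⟨y, hy, rfl⟩ := Option.map_eq_some_iff.1 h1
      cases sympl
      · simp [signedLetter]
      · simpa [signedLetter] using hdiag r x hx
  · rw [hU]
    have := hPQ r c
    cases h1 : entryG? (extract sympl U) r c <;> cases h2 : entryG? Q r c
    · rfl
    · simp_all
    · simp_all
    · simp only [Option.map_some, Option.bind_some, Option.some.injEq]
      refine (recordedSign_signedLetter _ ?_).symm
      rintro rfl rfl
      exact hdiag r _ h2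

theorem bijOn_tableauPairs (sympl : Bool) :
    Set.BijOn (fun a => (extract sympl (hmAuxCS sympl [] [] (wordCS a)).1,
      (hmAuxCS sympl [] [] (wordCS a)).2))
      {a : PWord | ∀ x ∈ a, 0 < x.ceil} (tableauPairs sympl) := by
  refine ⟨fun a ha => ?_, fun a ha b hb hab => ?_, fun PQ hPQ => ?_⟩
  · obtain ⟨M, hM⟩ := a.exists_ceil_lt
    exact (isRecording_word (M := M) a fun x hx => ⟨ha x hx, hM x hx⟩).mem_tableauPairs
  · obtain ⟨M, hM⟩ := (a ++ b).exists_ceil_lt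
    have ha' : ∀ x ∈ a, 0 < x.ceil ∧ x.ceil < M := fun x hx => ⟨ha x hx, hM x (by simp [hx])⟩
    have hb' : ∀ x ∈ b, 0 < x.ceil ∧ x.ceil < M := fun x hx => ⟨hb x hx, hM x (by simp [hx])⟩
    obtain ⟨h1, h2⟩ := Prod.mk.inj hab
    exact hmAuxCS_wordCS_injective a b ha' hb'
      ((isRecording_word a ha').eq_of_extract (isRecording_word b hb') h1 h2)
  · obtain ⟨M, n, U, hU, hrec⟩ := exists_isRecording hPQ
    obtain ⟨a, -, ha, hUQ⟩ := hrec.exists_word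
    refine ⟨a, ha, ?_⟩
    simp only [hUQ, hU]

end

/-- Corollary 5.12: orthogonal and symplectic mixed insertion are
bijections from primed words with positive letters to pairs `(P, Q)` of shifted tableaux
of the same shape with `P` semistandard and `Q` standard, where `Q` (resp. `P`) has no
primed entries on the main diagonal. -/
theorem stmt18 :
    Set.BijOn (fun a => (PHMO (wordCS a), QHMO (wordCS a)))
      {a : PWord | ∀ x ∈ a, 0 < x.ceil}
      {PQ : STab × STab | shapeOf PQ.1 = shapeOf PQ.2 ∧ IsShifted PQ.1 ∧ IsShifted PQ.2 ∧
        IsSemistandard PQ.1 ∧ IsStandard PQ.2 ∧ NoDiagPrimes PQ.2} ∧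
    Set.BijOn (fun a => (PHMSp (wordCS a), QHMSp (wordCS a)))
      {a : PWord | ∀ x ∈ a, 0 < x.ceil}
      {PQ : STab × STab | shapeOf PQ.1 = shapeOf PQ.2 ∧ IsShifted PQ.1 ∧ IsShifted PQ.2 ∧
        IsSemistandard PQ.1 ∧ IsStandard PQ.2 ∧ NoDiagPrimes PQ.1} := by
  exact ⟨bijOn_tableauPairs false, bijOn_tableauPairs true⟩
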